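/- Let r and s be integers with r + s ≢ 1 (mod p−1). Then for every a ∈ F^r and every b ∈ F^s, b is a norm from K = F(a^{1/p^n}) to F, i.e., b ∈ N_{K/F}(K^×), where a^{1/p^n} is any p^n-th root of a in an algebraic closure of F. -/

import Mathlib

/-- Membership in the group `F^r`: `x ∈ F^×` such that for every `σ ∈ Gal(F/E)`,
`σ(x)·x^{-c_σ^r} ∈ F^{×p^n}`, where `c_σ` is the cyclotomic character value of `σ`
(encoded as a unit of `ZMod (p^n)`). -/
def memFr (p n : ℕ) (E : Type) {F : Type} [Field E] [Field F] [Algebra E F]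
    (ζ : F) (r : ℤ) (x : F) : Prop :=
  x ≠ 0 ∧ ∀ (σ : F ≃ₐ[E] F) (u : (ZMod (p ^ n))ˣ),
    σ ζ = ζ ^ ((u : ZMod (p ^ n)).val) →
      ∃ w : F, σ x * (x ^ (((u ^ r : (ZMod (p ^ n))ˣ) : ZMod (p ^ n)).val))⁻¹ = w ^ (p ^ n)

/-- `b` is a norm from `F(y)` down to `F`. -/
def isNormFrom {F : Type} [Field F] (y : AlgebraicClosure F) (b : F) : Prop :=
  ∃ z : IntermediateField.adjoin F {y}, Algebra.norm F z = b

/-- The set of integers `f ≥ 0` such that every unit `u` of `F` with `v(u-1) ≥ f`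
is a norm from `F(y)`; its least element is the conductor of `F(y)/F`. -/
def condSet {F : Type} [Field F] (v : AddValuation F (WithTop ℤ))
    (y : AlgebraicClosure F) : Set ℕ :=
  {f : ℕ | ∀ u : F, v u = 0 → ((f : ℤ) : WithTop ℤ) ≤ v (u - 1) → isNormFrom y u}

section CupSymbol

variable (F L : Type*) [Field F] [Field L] [Algebra F L]

/-- The coboundary map from `1`-cochains to `2`-cochains of `Gal(L/F)` with values in `Lˣ`. -/
def coboundaryHom : (Gal(L/F) → Lˣ) →* (Gal(L/F) → Gal(L/F) → Lˣ) where
  toFun f g h := f g * Units.map (g : L →* L) (f h) / f (g * h)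
  map_one' := by ext; simp
  map_mul' f f' := by
    funext g h
    simp only [Pi.mul_apply, map_mul, div_eq_mul_inv, mul_inv_rev]
    ac_rfl

/-- `2`-cochains of `Gal(L/F)` with values in `Lˣ`, modulo coboundaries. -/
def CochainClass : Type _ :=
  (Gal(L/F) → Gal(L/F) → Lˣ) ⧸ (coboundaryHom F L).range

noncomputable instance : CommGroup (CochainClass F L) :=
  QuotientGroup.Quotient.commGroup (coboundaryHom F L).range

/-- The class of a `2`-cochain modulo coboundaries. -/
noncomputable def cochainClass : (Gal(L/F) → Gal(L/F) → Lˣ) →* CochainClass F L :=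
  QuotientGroup.mk' (coboundaryHom F L).range

variable {F L}

theorem cochainClass_eq_one_iff {φ : Gal(L/F) → Gal(L/F) → Lˣ} :
    cochainClass F L φ = 1 ↔ ∃ f, coboundaryHom F L f = φ :=
  QuotientGroup.eq_one_iff φ

theorem cochainClass_eq_iff {φ ψ : Gal(L/F) → Gal(L/F) → Lˣ} :
    cochainClass F L φ = cochainClass F L ψ ↔ ∃ f, coboundaryHom F L f = φ⁻¹ * ψ :=
  QuotientGroup.eq

theorem unitsMap_algebraMap_fixed (g : Gal(L/F)) (b : Fˣ) :
    Units.map (g : L →* L) (Units.map (algebraMap F L : F →* L) b) =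
      Units.map (algebraMap F L : F →* L) b := by
  ext; simp

/-- The cochain measuring the failure of `t` to be additive, in base `b`. -/
def carryCochain (m : ℕ) (t : Gal(L/F) → ℤ) : Fˣ →* (Gal(L/F) → Gal(L/F) → Lˣ) where
  toFun b g h := Units.map (algebraMap F L : F →* L) b ^ ((t g + t h - t (g * h)) / m)
  map_one' := by ext; simp
  map_mul' b b' := by funext g h; simp [mul_zpow]

/-- `t` lifts the Kummer character of `a`. -/
def IsKummerLift (m : ℕ) (ζ a : Fˣ) (t : Gal(L/F) → ℤ) : Prop :=
  ∃ α : Lˣ, α ^ m = Units.map (algebraMap F L : F →* L) a ∧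
    ∀ g : Gal(L/F), Units.map (g : L →* L) α =
      Units.map (algebraMap F L : F →* L) ζ ^ t g * α

section Kummer

variable {m : ℕ} [NeZero m] {ζ a b : Fˣ} {t t' : Gal(L/F) → ℤ}

omit [NeZero m] in
theorem isPrimitiveRoot_unitsMap (hζ : IsPrimitiveRoot ζ m) :
    IsPrimitiveRoot (Units.map (algebraMap F L : F →* L) ζ) m :=
  hζ.map_of_injective (Units.map_injective (algebraMap F L).injective)

theorem exists_zpow_of_pow_eq_one (hζ : IsPrimitiveRoot ζ m) {η : Lˣ} (h : η ^ m = 1) :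
    ∃ i : ℤ, η = Units.map (algebraMap F L : F →* L) ζ ^ i := by
  have h1 := (isPrimitiveRoot_unitsMap (L := L) hζ)
  have h2 : η ∈ rootsOfUnity m L := h
  rw [← h1.zpowers_eq] at h2
  obtain ⟨i, hi⟩ := Subgroup.mem_zpowers_iff.1 h2
  exact ⟨i, hi.symm⟩

theorem exists_isKummerLift (hζ : IsPrimitiveRoot ζ m) {α : Lˣ}
    (hα : α ^ m = Units.map (algebraMap F L : F →* L) a) :
    ∃ t : Gal(L/F) → ℤ, ∀ g : Gal(L/F), Units.map (g : L →* L) α =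
      Units.map (algebraMap F L : F →* L) ζ ^ t g * α := by
  have : ∀ g : Gal(L/F), ∃ i : ℤ, Units.map (g : L →* L) α =
      Units.map (algebraMap F L : F →* L) ζ ^ i * α := by
    intro g
    obtain ⟨i, hi⟩ := exists_zpow_of_pow_eq_one hζ (η := Units.map (g : L →* L) α / α) (by
      rw [div_pow, ← map_pow, hα, unitsMap_algebraMap_fixed, div_self'])
    exact ⟨i, by rw [← hi, div_mul_cancel]⟩
  choose t ht using this
  exact ⟨t, ht⟩

omit [NeZero m] in
theorem kummer_cocycle_dvd (hζ : IsPrimitiveRoot ζ m) {α : Lˣ}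
    (ht : ∀ g : Gal(L/F), Units.map (g : L →* L) α =
      Units.map (algebraMap F L : F →* L) ζ ^ t g * α) (g h : Gal(L/F)) :
    (m : ℤ) ∣ t g + t h - t (g * h) := by
  rw [← (isPrimitiveRoot_unitsMap (L := L) hζ).zpow_eq_one_iff_dvd]
  have h1 : Units.map ((g * h : Gal(L/F)) : L →* L) α =
      Units.map (g : L →* L) (Units.map (h : L →* L) α) := by ext; simp
  rw [ht h, map_mul, map_zpow, unitsMap_algebraMap_fixed, ht g, ht (g * h), ← mul_assoc] at h1
  have h2 := mul_right_cancel h1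
  rw [zpow_sub, zpow_add, h2, mul_comm (_ ^ t g), mul_inv_cancel]

omit [NeZero m] in
theorem IsKummerLift.dvd (hζ : IsPrimitiveRoot ζ m) (ht : IsKummerLift m ζ a t) (g h : Gal(L/F)) :
    (m : ℤ) ∣ t g + t h - t (g * h) := by
  obtain ⟨α, -, h⟩ := ht
  exact kummer_cocycle_dvd hζ h _ _

theorem IsKummerLift.dvd_sub (hζ : IsPrimitiveRoot ζ m) (ht : IsKummerLift m ζ a t)
    (ht' : IsKummerLift m ζ a t') (g : Gal(L/F)) : (m : ℤ) ∣ t g - t' g := by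
  obtain ⟨α, hα, h⟩ := ht
  obtain ⟨α', hα', h'⟩ := ht'
  obtain ⟨i, hi⟩ := exists_zpow_of_pow_eq_one hζ (η := α / α') (by
      rw [div_pow, hα, hα', div_self'])
  rw [← (isPrimitiveRoot_unitsMap (L := L) hζ).zpow_eq_one_iff_dvd]
  have h1 : α = Units.map (algebraMap F L : F →* L) ζ ^ i * α' := by
    rw [← hi, div_mul_cancel]
  have h2 := h g
  rw [h1, map_mul, map_zpow, unitsMap_algebraMap_fixed, h' g, mul_left_comm] at h2
  have h3 := mul_right_cancel h2
  rw [zpow_sub, h3, mul_inv_cancel]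

omit [NeZero m] in
theorem IsKummerLift.mul {a' : Fˣ} (ht : IsKummerLift m ζ a t) (ht' : IsKummerLift m ζ a' t') :
    IsKummerLift m ζ (a * a') (t + t') := by
  obtain ⟨α, hα, h⟩ := ht
  obtain ⟨α', hα', h'⟩ := ht'
  refine ⟨α * α', by rw [mul_pow, hα, hα', map_mul], fun g => ?_⟩
  rw [map_mul, h, h', Pi.add_apply, zpow_add, mul_mul_mul_comm]

/-- The class of the carry cochain depends only on the residues of `t` modulo `m`. -/
theorem mk_carryCochain_congr (h : ∀ g h, (m : ℤ) ∣ t g + t h - t (g * h))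
    (htt' : ∀ g, (m : ℤ) ∣ t g - t' g) (b : Fˣ) :
    cochainClass F L (carryCochain m t b) =
      cochainClass F L (carryCochain m t' b) := by
  choose s hs using htt'
  choose k hk using h
  have hm : (m : ℤ) ≠ 0 := by exact_mod_cast NeZero.ne m
  rw [cochainClass_eq_iff]
  refine ⟨fun g => Units.map (algebraMap F L : F →* L) b ^ (- s g), ?_⟩
  funext g h
  have e1 : t' g + t' h - t' (g * h) = m * (k g h - s g - s h + s (g * h)) := by
    linear_combination hk g h - hs g - hs h + hs (g * h)
  simp only [coboundaryHom, carryCochain, MonoidHom.coe_mk, OneHom.coe_mk, Pi.mul_apply,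
    Pi.inv_apply, map_zpow, unitsMap_algebraMap_fixed, hk, e1, Int.mul_ediv_cancel_left _ hm]
  rw [← zpow_neg, ← zpow_add, ← zpow_add, div_eq_mul_inv, ← zpow_neg, ← zpow_add]
  congr 1
  ring

theorem carryCochain_add (h : ∀ g h, (m : ℤ) ∣ t g + t h - t (g * h))
    (h' : ∀ g h, (m : ℤ) ∣ t' g + t' h - t' (g * h)) (b : Fˣ) :
    carryCochain m (t + t') b = carryCochain m t b * carryCochain m t' b := by
  choose k hk using h
  choose k' hk' using h'
  have hm : (m : ℤ) ≠ 0 := by exact_mod_cast NeZero.ne m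
  funext g h
  have e1 : (t + t') g + (t + t') h - (t + t') (g * h) = m * (k g h + k' g h) := by
    simp only [Pi.add_apply]
    linear_combination hk g h + hk' g h
  simp only [carryCochain, MonoidHom.coe_mk, OneHom.coe_mk, Pi.mul_apply,
    hk, hk', e1, Int.mul_ediv_cancel_left _ hm, zpow_add]

theorem carryCochain_nsmul (h : ∀ g h, (m : ℤ) ∣ t g + t h - t (g * h)) (k : ℕ) (b : Fˣ) :
    carryCochain m (k • t) b = carryCochain m t b ^ k := by
  choose s hs using h
  have hm : (m : ℤ) ≠ 0 := by exact_mod_cast NeZero.ne m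
  funext g h
  have e1 : (k • t) g + (k • t) h - (k • t) (g * h) = m * (s g h * k) := by
    simp only [Pi.smul_apply, nsmul_eq_mul]
    linear_combination k * hs g h
  simp only [carryCochain, MonoidHom.coe_mk, OneHom.coe_mk, Pi.pow_apply,
    hs, e1, Int.mul_ediv_cancel_left _ hm, zpow_mul, zpow_natCast]

theorem IsKummerLift.mk_eq (hζ : IsPrimitiveRoot ζ m) (ht : IsKummerLift m ζ a t)
    (ht' : IsKummerLift m ζ a t') (b : Fˣ) :
    cochainClass F L (carryCochain m t b) =
      cochainClass F L (carryCochain m t' b) :=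
  mk_carryCochain_congr (ht.dvd hζ) (ht.dvd_sub hζ ht') b

/-- Every element of `F` has an `m`-th root in `L`. -/
def HasKummerRoots (F L : Type*) [Field F] [Field L] [Algebra F L] (m : ℕ) : Prop :=
  ∀ a : Fˣ, ∃ α : Lˣ, α ^ m = Units.map (algebraMap F L : F →* L) a

theorem HasKummerRoots.exists_lift (hr : HasKummerRoots F L m) (hζ : IsPrimitiveRoot ζ m)
    (a : Fˣ) : ∃ t : Gal(L/F) → ℤ, IsKummerLift m ζ a t := by
  obtain ⟨α, hα⟩ := hr a
  obtain ⟨t, ht⟩ := exists_isKummerLift hζ hα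
  exact ⟨t, α, hα, ht⟩

/-- The symbol `(a, b)` obtained as cup product of the Kummer character of `a` with `b`. -/
noncomputable def cupSymbol (hr : HasKummerRoots F L m) (hζ : IsPrimitiveRoot ζ m) :
    Fˣ →* Fˣ →* CochainClass F L :=
  MonoidHom.mk' (fun a => (cochainClass F L).comp
    (carryCochain m (hr.exists_lift hζ a).choose)) (by
    intro a a'
    ext b
    have h := (hr.exists_lift hζ a).choose_spec
    have h' := (hr.exists_lift hζ a').choose_spec
    have h'' := (hr.exists_lift hζ (a * a')).choose_spec
    simp only [MonoidHom.comp_apply, MonoidHom.mul_apply]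
    rw [h''.mk_eq hζ (h.mul h'), carryCochain_add (h.dvd hζ) (h'.dvd hζ), map_mul])

theorem cupSymbol_eq (hr : HasKummerRoots F L m) (hζ : IsPrimitiveRoot ζ m)
    (ht : IsKummerLift m ζ a t) (b : Fˣ) :
    cupSymbol hr hζ a b = cochainClass F L (carryCochain m t b) :=
  (hr.exists_lift hζ a).choose_spec.mk_eq hζ ht b

end Kummer

end CupSymbol

section CupSymbolProperties

variable {F L : Type*} [Field F] [Field L] [Algebra F L] {m : ℕ} [NeZero m] {ζ a b : Fˣ}

/-- The symbol `(a, b)` vanishes if `b` is the product of an `m`-periodic sequence on which the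
Galois group acts by shifts through the Kummer character of `a`. -/
theorem cupSymbol_eq_one_of_prod (hr : HasKummerRoots F L m) (hζ : IsPrimitiveRoot ζ m)
    {t : Gal(L/F) → ℤ} (ht : IsKummerLift m ζ a t) (z : ℤ → Lˣ) (hz : ∀ i, z (i + m) = z i)
    (hg : ∀ (g : Gal(L/F)) i, Units.map (g : L →* L) (z i) = z (i + t g))
    (hb : ∏ i ∈ Finset.range m, z i = Units.map (algebraMap F L : F →* L) b) :
    cupSymbol hr hζ a b = 1 := by
  have hm : (m : ℤ) ≠ 0 := by exact_mod_cast NeZero.ne m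
  have hm0 : (0 : ℤ) < m := by have := NeZero.pos m; exact_mod_cast this
  have hzm : ∀ (k i : ℤ), z (i + m * k) = z i := by
    intro k
    induction k with
    | zero => simp
    | succ k ih => intro i; rw [mul_add, mul_one, ← add_assoc, hz, ih]
    | pred k ih => intro i; rw [← hz, ← ih i]; congr 1; ring
  set t' : Gal(L/F) → ℕ := fun g => (t g % m).toNat with ht'
  have ht'e : ∀ g, (t' g : ℤ) = t g % m := fun g => Int.toNat_of_nonneg (Int.emod_nonneg _ hm)
  have ht'm : ∀ g, t' g < m := fun g => by
    have := Int.emod_lt_of_pos (t g) hm0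
    rw [← ht'e] at this
    exact_mod_cast this
  have hsub : ∀ g, (m : ℤ) ∣ t g - (t' g : ℤ) := fun g => by
    rw [ht'e]; exact Int.dvd_self_sub_emod
  have hg' : ∀ (g : Gal(L/F)) (i : ℤ), Units.map (g : L →* L) (z i) = z (i + t' g) := by
    intro g i
    obtain ⟨k, hk⟩ := hsub g
    rw [hg, ← hzm k (i + t' g)]; congr 1; linarith
  rw [cupSymbol_eq hr hζ ht, mk_carryCochain_congr (ht.dvd hζ) hsub, cochainClass_eq_one_iff]
  refine ⟨fun g => ∏ i ∈ Finset.range (t' g), z i, ?_⟩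
  funext g h
  have hprod : (∏ i ∈ Finset.range (t' g), z i) *
      Units.map (g : L →* L) (∏ i ∈ Finset.range (t' h), z i) =
      ∏ i ∈ Finset.range (t' g + t' h), z i := by
    rw [Finset.prod_range_add, map_prod]
    congr 1
    refine Finset.prod_congr rfl fun i _ => ?_
    rw [hg' g i, add_comm]; push_cast; rfl
  have hdvd : (m : ℤ) ∣ (t' g : ℤ) + t' h - t' (g * h) := by
    obtain ⟨k, hk⟩ := ht.dvd hζ g h
    obtain ⟨k₁, hk₁⟩ := hsub g
    obtain ⟨k₂, hk₂⟩ := hsub h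
    obtain ⟨k₃, hk₃⟩ := hsub (g * h)
    exact ⟨k - k₁ - k₂ + k₃, by linear_combination hk - hk₁ - hk₂ + hk₃⟩
  obtain ⟨k, hk⟩ := hdvd
  have h1 := ht'm g
  have h2 := ht'm h
  have h3 := ht'm (g * h)
  simp only [coboundaryHom, carryCochain, MonoidHom.coe_mk, OneHom.coe_mk, hk,
    Int.mul_ediv_cancel_left _ hm]
  rw [hprod]
  have hk0 : -1 < k := by
    by_contra! hcon
    nlinarith
  have hk2 : k < 2 := by
    by_contra! hcon
    nlinarith
  have : k = 0 ∨ k = 1 := by omega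
  rcases this with rfl | rfl
  · have : t' g + t' h = t' (g * h) := by omega
    rw [this, div_self', zpow_zero]
  · have : t' g + t' h = t' (g * h) + m := by omega
    rw [this, zpow_one, ← hb, add_comm (t' (g * h)) m, Finset.prod_range_add, mul_div_assoc]
    conv_rhs => rw [← mul_one (∏ i ∈ Finset.range m, z i)]
    congr 1
    rw [div_eq_one]
    refine Finset.prod_congr rfl fun i _ => ?_
    rw [← hz i, add_comm]; push_cast; rfl

theorem cupSymbol_steinberg (hr : HasKummerRoots F L m) (hζ : IsPrimitiveRoot ζ m)
    (h : (a : F) + b = 1) : cupSymbol hr hζ a b = 1 := by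
  obtain ⟨α, hα⟩ := hr a
  obtain ⟨t, ht⟩ := exists_isKummerLift hζ hα
  have hζ' := isPrimitiveRoot_unitsMap (L := L) hζ
  set Z := Units.map (algebraMap F L : F →* L) ζ with hZ
  have hZm : Z ^ m = 1 := hζ'.pow_eq_one
  have hab : (algebraMap F L (a : F)) ≠ 1 := by
    intro hc
    rw [← map_one (algebraMap F L)] at hc
    have := (algebraMap F L).injective hc
    rw [this] at h
    exact b.ne_zero (by linear_combination h)
  have hne : ∀ i : ℤ, (1 : L) - ((Z ^ i * α : Lˣ) : L) ≠ 0 := by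
    intro i hi
    have h1 : Z ^ i * α = 1 := by ext; rw [Units.val_one]; linear_combination -hi
    have h2 : (Z ^ i * α) ^ m = 1 := by rw [h1, one_pow]
    rw [mul_pow, hα, ← zpow_natCast, ← zpow_mul, mul_comm i, zpow_mul, zpow_natCast, hZm, one_zpow,
      one_mul] at h2
    exact hab (by simpa using congrArg Units.val h2)
  refine cupSymbol_eq_one_of_prod hr hζ ⟨α, hα, ht⟩ (fun i => Units.mk0 _ (hne i)) ?_ ?_ ?_
  · intro i
    ext
    simp only [Units.val_mk0]
    rw [zpow_add, zpow_natCast, hZm, mul_one]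
  · intro g i
    ext
    simp only [Units.val_mk0, Units.coe_map]
    have := congrArg Units.val (ht g)
    have hgZ := congrArg Units.val (unitsMap_algebraMap_fixed (L := L) g (ζ ^ i))
    rw [map_zpow, ← hZ] at hgZ
    rw [Units.coe_map] at this hgZ
    rw [Units.val_mul, MonoidHom.coe_coe, map_sub, map_one, map_mul]
    rw [MonoidHom.coe_coe] at this hgZ
    rw [this, hgZ, zpow_add, Units.val_mul, Units.val_mul, Units.val_mul]
    ring
  · ext
    rw [Units.coe_prod]
    simp only [Units.val_mk0, Units.coe_map]
    have hp : IsPrimitiveRoot (Z : L) m := IsPrimitiveRoot.coe_units_iff.2 hζ'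
    have hαm : (α : L) ^ m = algebraMap F L a := by simpa using congrArg Units.val hα
    have hb : algebraMap F L b = 1 ^ m - (α : L) ^ m := by
      rw [hαm, one_pow, ← map_one (algebraMap F L), ← h, map_add]; ring
    rw [MonoidHom.coe_coe, hb, hp.pow_sub_pow_eq_prod_sub_mul 1 (α : L) (NeZero.pos m)]
    refine Finset.prod_nbij (fun i => (Z : L) ^ i) ?_ ?_ ?_ ?_
    · intro i _
      rw [Polynomial.mem_nthRootsFinset (NeZero.pos m), ← pow_mul, mul_comm, pow_mul,
        hp.pow_eq_one, one_pow]
    · intro i hi j hj hij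
      exact hp.pow_inj (by simpa using hi) (by simpa using hj) hij
    · intro η hη
      obtain ⟨i, hi, rfl⟩ := hp.eq_pow_of_pow_eq_one
        ((Polynomial.mem_nthRootsFinset (NeZero.pos m) (1 : L)).1 hη)
      exact ⟨i, by simpa using hi, rfl⟩
    · intro i _
      simp

theorem cupSymbol_pow_eq_one (hr : HasKummerRoots F L m) (hζ : IsPrimitiveRoot ζ m) :
    cupSymbol hr hζ a b ^ m = 1 := by
  have hm : (m : ℤ) ≠ 0 := by exact_mod_cast NeZero.ne m
  obtain ⟨t, ht⟩ := hr.exists_lift hζ a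
  rw [cupSymbol_eq hr hζ ht, ← map_pow, ← carryCochain_nsmul (ht.dvd hζ),
    mk_carryCochain_congr (t' := 0), ← map_one (cochainClass F L)]
  · congr 1
    funext g h
    simp [carryCochain]
  · intro g h
    simp only [Pi.smul_apply, nsmul_eq_mul]
    exact ⟨t g + t h - t (g * h), by ring⟩
  · intro g
    simp

/-- Transport of structure along a ring automorphism of `L` which stabilises `F`. -/
theorem exists_hom_cupSymbol (hr : HasKummerRoots F L m) (hζ : IsPrimitiveRoot ζ m)
    (σ : F ≃+* F) (τ : L ≃+* L) (hτ : ∀ x, τ (algebraMap F L x) = algebraMap F L (σ x))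
    (κ : ℕ) (hκ : σ ζ = (ζ : F) ^ κ) :
    ∃ θ : CochainClass F L →* CochainClass F L, ∀ a b : Fˣ, θ (cupSymbol hr hζ a b) =
      cupSymbol hr hζ (Units.map (σ : F →* F) a) (Units.map (σ : F →* F) b) := by
  have hτ' : ∀ x, τ.symm (algebraMap F L x) = algebraMap F L (σ.symm x) := fun x => by
    rw [RingEquiv.symm_apply_eq, hτ, RingEquiv.apply_symm_apply]
  let c : Gal(L/F) → Gal(L/F) := fun g =>
    AlgEquiv.ofRingEquiv (f := (τ.trans (g : L ≃+* L)).trans τ.symm) (fun x => by simp [hτ, hτ'])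
  have hc : ∀ g x, τ (c g x) = g (τ x) := fun g x => by simp [c]
  have hcmul : ∀ g h, c (g * h) = c g * c h := by
    intro g h; ext x; apply τ.injective; simp [hc]
  let T : (Gal(L/F) → Gal(L/F) → Lˣ) →* (Gal(L/F) → Gal(L/F) → Lˣ) :=
    { toFun := fun φ g h => Units.map (τ : L →* L) (φ (c g) (c h))
      map_one' := by funext g h; simp
      map_mul' := fun φ ψ => by funext g h; simp }
  have hT : (coboundaryHom F L).range ≤ (coboundaryHom F L).range.comap T := by
    rintro _ ⟨f, rfl⟩
    refine ⟨fun g => Units.map (τ : L →* L) (f (c g)), ?_⟩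
    funext g h
    ext
    simp [coboundaryHom, T, hc, hcmul]
  let θ₀ : CochainClass F L →* CochainClass F L := QuotientGroup.map _ _ T hT
  have hθ₀ : ∀ φ, θ₀ (cochainClass F L φ) = cochainClass F L (T φ) := fun φ => rfl
  refine ⟨(powMonoidHom κ).comp θ₀, fun a b => ?_⟩
  obtain ⟨t, α, hα, ht⟩ := hr.exists_lift hζ a
  have htc : ∀ g h, (m : ℤ) ∣ t (c g) + t (c h) - t (c (g * h)) := fun g h => by
    rw [hcmul]; exact kummer_cocycle_dvd hζ ht _ _
  have hL : IsKummerLift m ζ (Units.map (σ : F →* F) a) (κ • (t ∘ c)) := by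
    refine ⟨Units.map (τ : L →* L) α, ?_, fun g => ?_⟩
    · rw [← map_pow, hα]; ext; simp [hτ]
    · have h1 : Units.map (g : L →* L) (Units.map (τ : L →* L) α) =
          Units.map (τ : L →* L) (Units.map (c g : L →* L) α) := by ext; simp [hc]
      have h2 : Units.map (τ : L →* L) (Units.map (algebraMap F L : F →* L) ζ) =
          Units.map (algebraMap F L : F →* L) ζ ^ κ := by ext; simp [hτ, hκ]
      rw [h1, ht, map_mul, map_zpow, h2]
      simp only [Pi.smul_apply, Function.comp_apply, nsmul_eq_mul]
      rw [zpow_mul, zpow_natCast]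
  rw [cupSymbol_eq hr hζ ⟨α, hα, ht⟩, cupSymbol_eq hr hζ hL, carryCochain_nsmul (t := t ∘ c) htc, map_pow]
  simp only [MonoidHom.comp_apply, hθ₀, powMonoidHom_apply]
  congr 2
  funext g h
  ext
  simp [T, carryCochain, hcmul, hτ]

end CupSymbolProperties

section NormCriterion

open IntermediateField

variable {F L : Type*} [Field F] [Field L] [Algebra F L] {m : ℕ} [NeZero m] {ζ a b : Fˣ}

theorem apply_eq_self_of_mem_adjoin_simple {y x : L} (hx : x ∈ F⟮y⟯) {g : Gal(L/F)}
    (hg : g y = y) : g x = x := by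
  have : F⟮y⟯ ≤ fixedField (Subgroup.zpowers g) := by
    rw [adjoin_simple_le_iff, mem_fixedField_iff]
    intro f hf
    have : Subgroup.zpowers g ≤ MulAction.stabilizer Gal(L/F) y :=
      Subgroup.zpowers_le_of_mem hg
    exact this hf
  exact (mem_fixedField_iff _ _).1 (this hx) g (Subgroup.mem_zpowers g)

theorem mem_adjoin_simple_of_forall_apply_eq [FiniteDimensional F L] [IsGalois F L] {y x : L}
    (hx : ∀ g : Gal(L/F), g y = y → g x = x) : x ∈ F⟮y⟯ := by
  rw [← IsGalois.fixedField_fixingSubgroup F⟮y⟯, mem_fixedField_iff]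
  exact fun g hg => hx g ((mem_fixingSubgroup_iff _ _).1 hg y (mem_adjoin_simple_self F y))

/-- Hilbert 90 for the subgroup of `Gal(L/F)` fixing `y`. -/
theorem exists_div_eq_of_cocycle_on_fixing [FiniteDimensional F L] (y : L) (f : Gal(L/F) → Lˣ)
    (hf : ∀ g h : Gal(L/F), g y = y → h y = y →
      f (g * h) = f g * Units.map (g : L →* L) (f h)) :
    ∃ u : Lˣ, ∀ g : Gal(L/F), g y = y → f g = Units.map (g : L →* L) u / u := by
  let r : Gal(L/F⟮y⟯) → Gal(L/F) := fun g => ((fixingSubgroupEquiv F⟮y⟯).symm g : Gal(L/F))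
  have hr : ∀ g x, r g x = g x := fun g x => rfl
  have hry : ∀ g, r g y = y := fun g => by
    rw [hr]; exact g.commutes ⟨y, mem_adjoin_simple_self F y⟩
  obtain ⟨u, hu⟩ := groupCohomology.isMulCoboundary₁_of_isMulCocycle₁_of_aut_to_units
    (K := F⟮y⟯) (L := L) (fun g => f (r g)) (by
      intro g h
      have : r (g * h) = r g * r h := by ext; rfl
      simp only [this, hf _ _ (hry g) (hry h)]
      rw [mul_comm]
      rfl)
  refine ⟨u, fun g hg => ?_⟩
  let g' : Gal(L/F⟮y⟯) := fixingSubgroupEquiv F⟮y⟯ ⟨g, (mem_fixingSubgroup_iff _ _).2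
    fun x hx => apply_eq_self_of_mem_adjoin_simple hx hg⟩
  exact (hu g').symm

/-- An element of `F` whose symbol with `a` vanishes is a norm from `F(a^{1/m})`. -/
theorem exists_norm_eq_of_cupSymbol_eq_one [FiniteDimensional F L] [IsGalois F L]
    (hr : HasKummerRoots F L m) (hζ : IsPrimitiveRoot ζ m) (y : Lˣ)
    (hy : y ^ m = Units.map (algebraMap F L : F →* L) a) (hab : cupSymbol hr hζ a b = 1) :
    ∃ z : F⟮(y : L)⟯, Algebra.norm F z = b := by
  have hm : (m : ℤ) ≠ 0 := by exact_mod_cast NeZero.ne m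
  have hm0 : (0 : ℤ) < m := by have := NeZero.pos m; exact_mod_cast this
  have hZ := isPrimitiveRoot_unitsMap (L := L) hζ
  set Z := Units.map (algebraMap F L : F →* L) ζ with hZdef
  obtain ⟨t₀, ht₀⟩ := exists_isKummerLift (L := L) hζ hy
  obtain ⟨t, htlt, htnn, ht⟩ : ∃ t : Gal(L/F) → ℤ, (∀ g, t g < m) ∧ (∀ g, 0 ≤ t g) ∧
      ∀ g : Gal(L/F), Units.map (g : L →* L) y = Z ^ t g * y := by
    refine ⟨fun g => t₀ g % m, fun g => Int.emod_lt_of_pos _ hm0,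
      fun g => Int.emod_nonneg _ hm, fun g => ?_⟩
    rw [ht₀ g]
    congr 1
    rw [← div_eq_one, ← hZdef, div_eq_mul_inv, ← zpow_sub, hZ.zpow_eq_one_iff_dvd]
    exact Int.dvd_self_sub_emod
  have htuniq : ∀ (g : Gal(L/F)) (k : ℤ), Units.map (g : L →* L) y = Z ^ k * y →
      (m : ℤ) ∣ k - t g := by
    intro g k hk
    rw [ht g] at hk
    rw [← hZ.zpow_eq_one_iff_dvd, zpow_sub, ← mul_right_cancel hk, mul_inv_cancel]
  have htuniq' : ∀ (g : Gal(L/F)) (k : ℤ), Units.map (g : L →* L) y = Z ^ k * y →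
      0 ≤ k → k < m → t g = k := by
    intro g k hk h0 h1
    have := htuniq g k hk
    have h2 := Int.eq_zero_of_abs_lt_dvd this (by
      rw [abs_lt]; constructor <;> linarith [htlt g, htnn g])
    linarith
  have hfix : ∀ g : Gal(L/F), g (y : L) = y ↔ t g = 0 := by
    intro g
    constructor
    · intro h
      exact htuniq' g 0 (by ext; simpa using h) le_rfl hm0
    · intro h
      have := congrArg Units.val (ht g)
      simpa [h] using this
  have hcomp : ∀ g h : Gal(L/F), Units.map ((g * h : Gal(L/F)) : L →* L) y =
      Z ^ (t g + t h) * y := by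
    intro g h
    have h1 : Units.map ((g * h : Gal(L/F)) : L →* L) y =
      Units.map (g : L →* L) (Units.map (h : L →* L) y) := by ext; simp
    rw [h1, ht h, map_mul, map_zpow, unitsMap_algebraMap_fixed, ht g, add_comm, zpow_add, mul_assoc]
  have htr : ∀ g h : Gal(L/F), t h = 0 → t (g * h) = t g := fun g h hh =>
    htuniq' _ _ (by rw [hcomp, hh, add_zero]) (htnn g) (htlt g)
  have htl : ∀ g h : Gal(L/F), t h = 0 → t (h * g) = t g := fun g h hh =>
    htuniq' _ _ (by rw [hcomp, hh, zero_add]) (htnn g) (htlt g)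
  rw [cupSymbol_eq hr hζ ⟨y, hy, ht⟩, cochainClass_eq_one_iff] at hab
  obtain ⟨f, hf⟩ := hab
  have hf' : ∀ g h : Gal(L/F), f g * Units.map (g : L →* L) (f h) =
      Units.map (algebraMap F L : F →* L) b ^ ((t g + t h - t (g * h)) / m) * f (g * h) := by
    intro g h
    rw [← div_eq_iff_eq_mul]
    exact congrFun (congrFun hf g) h
  obtain ⟨u, hu⟩ := exists_div_eq_of_cocycle_on_fixing (y : L) f (by
    intro g h hg hh
    rw [hfix] at hg hh
    rw [hf', hg, hh, htr _ _ hh, hg]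
    simp)
  obtain ⟨f', hf'1, hf'⟩ : ∃ f' : Gal(L/F) → Lˣ, (∀ g, t g = 0 → f' g = 1) ∧
      ∀ g h : Gal(L/F), f' g * Units.map (g : L →* L) (f' h) =
      Units.map (algebraMap F L : F →* L) b ^ ((t g + t h - t (g * h)) / m) * f' (g * h) := by
    refine ⟨fun g => f g * (u / Units.map (g : L →* L) u), fun g hg => ?_, fun g h => ?_⟩
    · simp only [hu g ((hfix g).2 hg)]; simp
    · have h1 : Units.map ((g * h : Gal(L/F)) : L →* L) u =
        Units.map (g : L →* L) (Units.map (h : L →* L) u) := by ext; simp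
      rw [← mul_assoc, ← hf', h1, map_mul, map_div]
      rw [mul_mul_mul_comm, div_mul_div_cancel]
  have hmemK : ∀ g, ((f' g : Lˣ) : L) ∈ F⟮(y : L)⟯ := by
    intro g
    refine mem_adjoin_simple_of_forall_apply_eq fun h hh => ?_
    rw [hfix] at hh
    have h1 := hf' h g
    rw [hf'1 h hh, one_mul, hh, htl _ _ hh, zero_add, sub_self, Int.zero_ediv, zpow_zero,
      one_mul] at h1
    have hconj : t (g⁻¹ * (h * g)) = 0 := by
      rw [← hfix]
      have h3 := (ht (h * g)).trans (by rw [htl _ _ hh, ← ht g])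
      have h4 := congrArg Units.val h3
      simp only [Units.coe_map, MonoidHom.coe_coe, AlgEquiv.mul_apply] at h4 ⊢
      rw [h4, ← AlgEquiv.mul_apply, inv_mul_cancel, AlgEquiv.one_apply]
    have h2 := hf' g (g⁻¹ * (h * g))
    rw [hf'1 _ hconj, hconj, map_one, mul_one, add_zero, mul_inv_cancel_left, htl _ _ hh, sub_self,
      Int.zero_ediv, zpow_zero, one_mul] at h2
    rw [← h2] at h1
    simpa using congrArg Units.val h1
  have hone : t 1 = 0 := (hfix 1).1 rfl
  by_cases hall : ∀ g, t g = 0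
  · have hybot : F⟮(y : L)⟯ = ⊥ := by
      rw [adjoin_simple_eq_bot_iff, IsGalois.mem_bot_iff_fixed]
      exact fun g => (hfix g).2 (hall g)
    refine ⟨algebraMap F _ b, ?_⟩
    rw [Algebra.norm_algebraMap, IntermediateField.finrank_eq_one_iff.2 hybot, pow_one]
  push Not at hall
  have hex : ∃ d : ℕ, 0 < d ∧ ∃ g, t g = d := by
    obtain ⟨g, hg⟩ := hall
    refine ⟨(t g).toNat, ?_, g, ?_⟩ <;> have := htnn g <;> omega
  classical
  obtain ⟨hd0, g₀, hg₀⟩ := Nat.find_spec hex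
  have hmin : ∀ g, t g < (Nat.find hex : ℕ) → t g = 0 := by
    intro g hg
    by_contra hne
    have h1 := htnn g
    refine Nat.find_min hex (m := (t g).toNat) (by omega) ⟨by omega, g, by omega⟩
  set d := Nat.find hex with hd
  have hdm : (d : ℤ) < m := hg₀ ▸ htlt g₀
  have hpow : ∀ i : ℕ, (d * i : ℤ) < m → t (g₀ ^ i) = d * i := by
    intro i
    induction i with
    | zero => intro _; simpa using hone
    | succ i ih =>
      intro hi
      push_cast at hi ⊢
      have h1 : t (g₀ ^ i) = d * i := ih (by linarith)
      refine htuniq' _ _ ?_ (by positivity) hi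
      rw [pow_succ, hcomp, h1, hg₀, mul_add, mul_one]
  have hstep : ∀ i : ℕ, (d * i : ℤ) < m → (m : ℤ) ≤ d * i + d →
      t (g₀ ^ (i + 1)) = d * i + d - m := by
    intro i h1 h2
    refine htuniq' _ _ ?_ (by linarith) (by linarith)
    rw [pow_succ, hcomp, hpow i h1, hg₀, zpow_sub, zpow_natCast, hZ.pow_eq_one, inv_one, mul_one]
  obtain ⟨M, hM⟩ : d ∣ m := by
    by_contra hnd
    have h0 : m % d ≠ 0 := fun h => hnd (Nat.dvd_of_mod_eq_zero h)
    have h1 := Nat.mod_lt m hd0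
    have h2 := Nat.div_add_mod m d
    have h3 : (d : ℤ) * (m / d : ℕ) + (m % d : ℕ) = m := by exact_mod_cast h2
    have h4 := hstep (m / d) (by omega) (by omega)
    have h5 := hmin (g₀ ^ (m / d + 1)) (by omega)
    omega
  have hM' : (m : ℤ) = d * M := by rw [hM]; push_cast; ring
  have hd0' : (0 : ℤ) < d := by exact_mod_cast hd0
  have hlt : ∀ i : ℕ, i < M → (d * i : ℤ) < m := fun i hi => by
    rw [hM']
    exact mul_lt_mul_of_pos_left (by exact_mod_cast hi) hd0'
  have hgen : ∀ g, ∃ i < M, t (g₀ ^ i) = t g := by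
    intro g
    have h1 := Int.emod_nonneg (t g) hd0'.ne'
    have h2 := Int.emod_lt_of_pos (t g) hd0'
    have h3 := Int.mul_ediv_add_emod (t g) d
    have h4 : 0 ≤ t g / d := Int.ediv_nonneg (htnn g) hd0'.le
    obtain ⟨j, hj⟩ := Int.eq_ofNat_of_zero_le h4
    have hjm : (d * j : ℤ) < m := by rw [← hj]; linarith [htlt g]
    have hjM : j < M := by
      rw [hM'] at hjm
      exact_mod_cast lt_of_mul_lt_mul_left hjm hd0'.le
    refine ⟨j, hjM, ?_⟩
    have h5 := hcomp (g₀ ^ j) ((g₀ ^ j)⁻¹ * g)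
    rw [mul_inv_cancel_left] at h5
    have h6 := htuniq _ _ h5
    rw [hpow j hjm] at h6 ⊢
    have h7 : t ((g₀ ^ j)⁻¹ * g) - t g % d = 0 := by
      refine Int.eq_zero_of_abs_lt_dvd (m := m) ?_ ?_
      · convert h6 using 1
        rw [← h3, hj]
        simp only [Int.mul_add_emod_self_left, Int.emod_emod_of_dvd, dvd_refl]
        ring
      · rw [abs_lt]
        constructor <;> linarith [htlt ((g₀ ^ j)⁻¹ * g), htnn ((g₀ ^ j)⁻¹ * g)]
    have h8 := hmin ((g₀ ^ j)⁻¹ * g) (by linarith)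
    rw [← h3, hj]
    linarith
  have hprod : ∀ i < M, ∏ j ∈ Finset.range i, Units.map ((g₀ ^ j : Gal(L/F)) : L →* L) (f' g₀) =
      f' (g₀ ^ i) := by
    intro i
    induction i with
    | zero => intro _; simp [hf'1 1 hone]
    | succ i ih =>
      intro hi
      rw [Finset.prod_range_succ, ih (by omega), hf', ← pow_succ, hpow i (hlt i (by omega)),
        hpow _ (hlt _ hi), hg₀]
      have : (d * i + d - d * ((i + 1 : ℕ) : ℤ) : ℤ) = 0 := by push_cast; ring
      rw [this, Int.zero_ediv, zpow_zero, one_mul]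
  have hM0 : 0 < M := by
    rcases Nat.eq_zero_or_pos M with h | h
    · simp [h] at hM; exact absurd hM (NeZero.ne m)
    · exact h
  have hprodM : ∏ j ∈ Finset.range M, Units.map ((g₀ ^ j : Gal(L/F)) : L →* L) (f' g₀) =
      Units.map (algebraMap F L : F →* L) b := by
    obtain ⟨N, rfl⟩ : ∃ N, M = N + 1 := ⟨M - 1, by omega⟩
    have h1 := hlt N (by omega)
    have h2 : (d * N + d : ℤ) = m := by rw [hM']; push_cast; ring
    have h3 := hstep N h1 h2.ge
    rw [h2, sub_self] at h3
    rw [Finset.prod_range_succ, hprod N (by omega), hf', ← pow_succ, hf'1 _ h3, h3, hpow N h1, hg₀,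
      h2, sub_zero, Int.ediv_self hm, zpow_one, mul_one]
  have hnormal : Normal F F⟮(y : L)⟯ := by
    rw [normal_iff_forall_map_le']
    intro g
    rw [adjoin_map, Set.image_singleton, adjoin_simple_le_iff]
    have h1 : (g : L →ₐ[F] L) (y : L) = ((Z ^ t g : Lˣ) : L) * y := congrArg Units.val (ht g)
    rw [h1]
    refine mul_mem ?_ (mem_adjoin_simple_self F _)
    rw [hZdef, ← map_zpow]
    exact IntermediateField.algebraMap_mem _ _
  have hgal : IsGalois F F⟮(y : L)⟯ := ⟨⟩
  let w : F⟮(y : L)⟯ := ⟨f' g₀, hmemK g₀⟩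
  refine ⟨w, (algebraMap F L).injective ?_⟩
  rw [IsScalarTower.algebraMap_apply F F⟮(y : L)⟯ L, Algebra.norm_eq_prod_automorphisms, map_prod]
  have hb := congrArg Units.val hprodM
  rw [Units.coe_prod] at hb
  refine Eq.trans ?_ hb
  let K := F⟮(y : L)⟯
  have hres : ∀ (g : Gal(L/F)) (x : K), ((AlgEquiv.restrictNormalHom K g x : K) : L) = g x :=
    fun g x => AlgEquiv.restrictNormal_commutes g K x
  have hagree : ∀ g h : Gal(L/F), AlgEquiv.restrictNormalHom K g = AlgEquiv.restrictNormalHom K h ↔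
      t g = t h := by
    intro g h
    constructor
    · intro hgh
      have h1 := hres g ⟨y, mem_adjoin_simple_self F _⟩
      rw [hgh, hres] at h1
      exact htuniq' g _ (by ext; simpa [ht h] using h1.symm.trans (congrArg Units.val (ht h)))
        (htnn h) (htlt h)
    · intro hgh
      have h1 : (h⁻¹ * g) (y : L) = y := by
        have h3 : Units.map (g : L →* L) y = Units.map (h : L →* L) y := by rw [ht g, hgh, ← ht h]
        have h2 : g (y : L) = h y := congrArg Units.val h3
        rw [AlgEquiv.mul_apply, h2, ← AlgEquiv.mul_apply, inv_mul_cancel, AlgEquiv.one_apply]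
      ext x
      rw [hres, hres]
      have h2 := apply_eq_self_of_mem_adjoin_simple x.2 h1
      conv_rhs => rw [← h2]
      rw [← AlgEquiv.mul_apply, mul_inv_cancel_left]
  symm
  refine Finset.prod_nbij (fun i => AlgEquiv.restrictNormalHom K (g₀ ^ i)) ?_ ?_ ?_ ?_
  · intro i _; exact Finset.mem_univ _
  · intro i hi j hj hij
    rw [Finset.coe_range, Set.mem_Iio] at hi hj
    have h1 := (hagree _ _).1 hij
    rw [hpow i (hlt i hi), hpow j (hlt j hj)] at h1
    exact_mod_cast mul_left_cancel₀ hd0'.ne' h1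
  · intro σ _
    obtain ⟨g, rfl⟩ := AlgEquiv.restrictNormalHom_surjective (F := F) (K₁ := K) L σ
    obtain ⟨i, hi, h⟩ := hgen g
    exact ⟨i, by simpa using hi, (hagree _ _).2 h⟩
  · intro i _
    exact (hres (g₀ ^ i) w).symm

end NormCriterion

section LocalSymbol

/-- The properties of the valuation ring `O` of a local field with perfect residue field of
characteristic `p` that are used to control symbols modulo `p`; `π` is a uniformizer, and `N` plays
the role of `p e / (p - 1)`, with `e` the absolute ramification index. -/
structure IsLocalOrder (p N : ℕ) {F : Type*} [Field F] (O : Subring F) (π : Fˣ) : Prop where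
  unif_mem : (π : F) ∈ O
  exists_factor : ∀ x : Fˣ, ∃ (k : ℤ) (u : Fˣ), x = π ^ k * u ∧ (u : F) ∈ O ∧ ((u⁻¹ : Fˣ) : F) ∈ O
  exists_one_add : ∀ α ∈ O, ∃ u : Fˣ, (u : F) = 1 + α * π ∧ ((u⁻¹ : Fˣ) : F) ∈ O
  unit_or_dvd : ∀ α ∈ O, (∃ u : Fˣ, (u : F) = α ∧ ((u⁻¹ : Fˣ) : F) ∈ O) ∨ ∃ γ ∈ O, α = γ * π
  exists_pth_root : ∀ α ∈ O, ∃ β ∈ O, ∃ γ ∈ O, α = β ^ p + γ * π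
  prime_mul : ∀ j, 1 ≤ j → p * j < N → ∃ γ ∈ O, (p : F) * (π : F) ^ j = γ * (π : F) ^ (p * j + 1)

variable {p N : ℕ} {F : Type*} [Field F] {O : Subring F} {π : Fˣ} {Q : Type*} [CommGroup Q]

section Skew

variable {ψ : Fˣ →* Fˣ →* Q} (hS : ∀ x y : Fˣ, (x : F) + y = 1 → ψ x y = 1)

include hS

theorem symbol_neg_self (a : Fˣ) : ψ a (-a) = 1 := by
  rcases eq_or_ne a 1 with rfl | ha
  · simp
  have ha' : (a : F) ≠ 1 := fun h => ha (Units.ext h)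
  have h0 : (a : F) ≠ 0 := a.ne_zero
  have h1 : 1 - (a : F) ≠ 0 := sub_ne_zero.2 ha'.symm
  have h2 : 1 - (a : F)⁻¹ ≠ 0 := sub_ne_zero.2 fun h => ha' (by rw [← inv_inv (a : F), ← h, inv_one])
  have h3 := hS a (Units.mk0 _ h1) (by simp)
  have h4 := hS a⁻¹ (Units.mk0 _ h2) (by simp)
  have h5 : -a = Units.mk0 _ h1 * (Units.mk0 _ h2)⁻¹ := by
    rw [eq_mul_inv_iff_mul_eq]
    ext
    simp only [Units.val_mul, Units.val_neg, Units.val_mk0]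
    field_simp
    ring
  rw [map_inv, MonoidHom.inv_apply, inv_eq_one] at h4
  rw [h5, map_mul, map_inv, h3, h4, inv_one, mul_one]

theorem symbol_self (hp : Odd p) (hψ : ∀ x y, ψ x y ^ p = 1) (a : Fˣ) : ψ a a = 1 := by
  have h1 := symbol_neg_self hS a
  have h2 : ψ a (-1) = 1 := by
    rw [← hp.neg_one_pow, map_pow, hψ]
  rw [← neg_one_mul, map_mul, h2, one_mul] at h1
  exact h1

theorem symbol_swap_eq_one (hp : Odd p) (hψ : ∀ x y, ψ x y ^ p = 1) {a b : Fˣ} (h : ψ a b = 1) :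
    ψ b a = 1 := by
  have h1 := symbol_self hS hp hψ (a * b)
  simpa [h, symbol_self hS hp hψ] using h1

end Skew

namespace IsLocalOrder

variable (hO : IsLocalOrder p N O π)

include hO

theorem not_dvd_unit {u : Fˣ} (hu : ((u⁻¹ : Fˣ) : F) ∈ O) {γ : F} (hγ : γ ∈ O) : (u : F) ≠ γ * π := by
  intro h
  obtain ⟨w, hw, -⟩ := hO.exists_one_add (-(γ * (u⁻¹ : Fˣ))) (neg_mem (mul_mem hγ hu))
  apply w.ne_zero
  rw [hw]
  have h1 : (u : F) * (u⁻¹ : Fˣ) = 1 := by simp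
  linear_combination h1 * (-1 : F) + (u⁻¹ : Fˣ) * h

theorem exists_one_add_pow {k : ℕ} (h : 1 ≤ k) {α : F} (hα : α ∈ O) :
    ∃ u : Fˣ, (u : F) = 1 + α * (π : F) ^ k ∧ ((u⁻¹ : Fˣ) : F) ∈ O := by
  obtain ⟨k, rfl⟩ := Nat.exists_eq_add_of_le h
  obtain ⟨u, hu, hu'⟩ := hO.exists_one_add (α * (π : F) ^ k) (mul_mem hα (pow_mem hO.unif_mem k))
  exact ⟨u, by rw [hu]; ring, hu'⟩

/-- A unit is a `p`-th power up to a principal unit. -/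
theorem exists_eq_pow_mul {u : Fˣ} (hu : (u : F) ∈ O) (hu' : ((u⁻¹ : Fˣ) : F) ∈ O) (hp0 : p ≠ 0) :
    ∃ β w : Fˣ, u = β ^ p * w ∧ ∃ α ∈ O, (w : F) = 1 + α * π := by
  obtain ⟨β, hβ, γ, hγ, h⟩ := hO.exists_pth_root u hu
  rcases hO.unit_or_dvd β hβ with ⟨b, rfl, hb⟩ | ⟨δ, hδ, rfl⟩
  · refine ⟨b, (b ^ p)⁻¹ * u, by simp, γ * ((b⁻¹ : Fˣ) : F) ^ p, mul_mem hγ (pow_mem hb p), ?_⟩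
    have h1 : ((b⁻¹ : Fˣ) : F) ^ p * (b : F) ^ p = 1 := by simp
    simp only [Units.val_mul, h, ← inv_pow, Units.val_pow_eq_pow_val]
    linear_combination h1
  · obtain ⟨q, rfl⟩ : ∃ q, p = q + 1 := ⟨p - 1, by omega⟩
    refine absurd ?_ (hO.not_dvd_unit hu'
      (add_mem (mul_mem (pow_mem hδ (q + 1)) (pow_mem hO.unif_mem q)) hγ))
    rw [h]
    ring

variable {ψ : Fˣ →* Fˣ →* Q} (hS : ∀ x y : Fˣ, (x : F) + y = 1 → ψ x y = 1)
  (hp : Odd p) (hψ : ∀ x y, ψ x y ^ p = 1)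

include hS hp hψ

/-- If a symbol is trivial on principal units of level `k + 1`, then units pair trivially with
principal units of level `k`. -/
theorem symbol_unit_eq_one {k : ℕ}
    (H : ∀ x u : Fˣ, (∃ α ∈ O, (u : F) = 1 + α * (π : F) ^ (k + 1)) → ψ x u = 1)
    {v u : Fˣ} (hv : (v : F) ∈ O) (hv' : ((v⁻¹ : Fˣ) : F) ∈ O)
    (hu : ∃ α ∈ O, (u : F) = 1 + α * (π : F) ^ k) : ψ v u = 1 := by
  obtain ⟨β, w, rfl, α', hα', hw⟩ := hO.exists_eq_pow_mul hv hv' hp.pos.ne'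
  obtain ⟨α, hα, hu⟩ := hu
  have h1 : ψ w u = 1 := by
    rcases eq_or_ne α' 0 with rfl | h0
    · have : w = 1 := by ext; simpa using hw
      simp [this]
    have hx0 : -(α' * π) ≠ 0 := neg_ne_zero.2 (mul_ne_zero h0 π.ne_zero)
    let x := Units.mk0 _ hx0
    obtain ⟨d, hd, -⟩ := hO.exists_one_add_pow (Nat.le_add_left 1 k) (neg_mem (mul_mem hα' hα))
    have hd1 : ∀ z, ψ z d = 1 := fun z => H z d ⟨_, neg_mem (mul_mem hα' hα), hd⟩
    have hd2 : ∀ z, ψ d z = 1 := fun z => symbol_swap_eq_one hS hp hψ (hd1 z)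
    have hwx : ψ w x = 1 := hS _ _ (by simp [x, hw])
    have hd0 : (d : F) ≠ 0 := d.ne_zero
    have h2 := hS (w * d⁻¹) (x * u * d⁻¹) (by
      simp only [Units.val_mul, Units.val_inv_eq_inv_val]
      field_simp
      rw [hw, hu, hd]
      simp only [x, Units.val_mk0]
      ring)
    simpa [hd1, hd2, hwx] using h2
  simp [h1, hψ]

theorem symbol_level_step (hpp : p.Prime) {k : ℕ} (hk : 1 ≤ k) (hkN : k < N)
    (H : ∀ x u : Fˣ, (∃ α ∈ O, (u : F) = 1 + α * (π : F) ^ (k + 1)) → ψ x u = 1)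
    (x u : Fˣ) (hu : ∃ α ∈ O, (u : F) = 1 + α * (π : F) ^ k) : ψ x u = 1 := by
  by_cases hpk : p ∣ k
  · obtain ⟨j, rfl⟩ := hpk
    have hj : 1 ≤ j := by
      rcases Nat.eq_zero_or_pos j with rfl | h
      · simp at hk
      · exact h
    obtain ⟨α, hα, hu⟩ := hu
    obtain ⟨β, hβ, γ, hγ, rfl⟩ := hO.exists_pth_root α hα
    obtain ⟨η, hη, hη'⟩ := hO.prime_mul j hj hkN
    obtain ⟨w, hw, hw'⟩ := hO.exists_one_add_pow hj hβ
    obtain ⟨r, hr⟩ := exists_add_pow_prime_eq hpp (⟨β * (π : F) ^ j,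
      mul_mem hβ (pow_mem hO.unif_mem j)⟩ : O) 1
    have hr' := congrArg (Subtype.val) hr
    simp only [Subring.coe_add, Subring.coe_mul, Subring.coe_pow, Subring.coe_one,
      Subring.coe_natCast, one_pow, mul_one] at hr'
    have hu2 : u = w ^ p * ((w ^ p)⁻¹ * u) := by simp
    rw [hu2, map_mul, map_pow, hψ, one_mul]
    refine H _ _ ⟨(γ - η * β * r) * ((w⁻¹ : Fˣ) : F) ^ p, mul_mem (sub_mem hγ
      (mul_mem (mul_mem hη hβ) r.2)) (pow_mem hw' p), ?_⟩
    have h1 : ((w⁻¹ : Fˣ) : F) ^ p * (w : F) ^ p = 1 := by simp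
    rw [hw, add_comm 1 (β * (π : F) ^ j), hr'] at h1
    simp only [Units.val_mul, ← inv_pow, Units.val_pow_eq_pow_val]
    rw [hu]
    linear_combination h1 - ((w⁻¹ : Fˣ) : F) ^ p * β * r * hη'
  · obtain ⟨l, v, rfl, hv, hv'⟩ := hO.exists_factor x
    have h1 : ψ v u = 1 := hO.symbol_unit_eq_one hS hp hψ H hv hv' hu
    have h2 : ψ π u = 1 := by
      obtain ⟨α, hα, hu'⟩ := hu
      rcases hO.unit_or_dvd α hα with ⟨a, rfl, ha'⟩ | ⟨γ, hγ, rfl⟩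
      · have h3 := hS (-a * π ^ k) u (by simp [hu'])
        have h4 : ψ (-a) u = 1 := hO.symbol_unit_eq_one hS hp hψ H
          (by simpa using hα) (by simpa using ha') ⟨_, hα, hu'⟩
        rw [map_mul, MonoidHom.mul_apply, h4, one_mul, map_pow, MonoidHom.pow_apply] at h3
        have h5 := (hpp.coprime_iff_not_dvd.2 hpk)
        have h6 := orderOf_dvd_of_pow_eq_one h3
        have h7 := orderOf_dvd_of_pow_eq_one (hψ π u)
        exact orderOf_eq_one_iff.1 (Nat.dvd_one.1 (h5 ▸ Nat.dvd_gcd h7 h6))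
      · exact H _ _ ⟨γ, hγ, by rw [hu']; ring⟩
    simp [h1, h2]

/-- A Steinberg symbol of exponent `p` that vanishes on principal units of level `N` is trivial. -/
theorem symbol_eq_one (hpp : p.Prime) (hN : 1 ≤ N)
    (H : ∀ x u : Fˣ, (∃ α ∈ O, (u : F) = 1 + α * (π : F) ^ N) → ψ x u = 1) (x y : Fˣ) :
    ψ x y = 1 := by
  have h1 : ∀ x u : Fˣ, (∃ α ∈ O, (u : F) = 1 + α * (π : F) ^ 1) → ψ x u = 1 := by
    refine Nat.decreasingInduction' (P := fun k => ∀ x u : Fˣ,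
      (∃ α ∈ O, (u : F) = 1 + α * (π : F) ^ k) → ψ x u = 1) ?_ hN H
    intro k hkN hk H'
    exact hO.symbol_level_step hS hp hψ hpp hk hkN H'
  have h2 : ∀ x u : Fˣ, (u : F) ∈ O → ((u⁻¹ : Fˣ) : F) ∈ O → ψ x u = 1 := by
    intro x u hu hu'
    obtain ⟨β, w, rfl, α, hα, hw⟩ := hO.exists_eq_pow_mul hu hu' hp.pos.ne'
    rw [map_mul, map_pow, hψ, one_mul]
    exact h1 _ _ ⟨α, hα, by rw [hw, pow_one]⟩
  obtain ⟨k, u, rfl, hu, hu'⟩ := hO.exists_factor x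
  obtain ⟨l, v, rfl, hv, hv'⟩ := hO.exists_factor y
  have h3 : ψ u π = 1 := symbol_swap_eq_one hS hp hψ (h2 π u hu hu')
  simp [h2 _ v hv hv', h3, symbol_self hS hp hψ]

end IsLocalOrder

/-- The `i`-th subgroup in the filtration of the group generated by the values of a symbol by powers
of `p`. -/
def symbolPowers (c : Fˣ →* Fˣ →* Q) (p i : ℕ) : Subgroup Q :=
  (Subgroup.closure {z | ∃ x y, c x y = z}).map (powMonoidHom (p ^ i))

theorem symbol_pow_mem (c : Fˣ →* Fˣ →* Q) (p i : ℕ) (x y : Fˣ) :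
    c x y ^ p ^ i ∈ symbolPowers c p i :=
  ⟨c x y, Subgroup.subset_closure ⟨x, y, rfl⟩, rfl⟩

/-- An automorphism which scales a uniformizer by `κ` modulo the maximal ideal and acts trivially on
the residue field raises symbols to the power `κ`, modulo `p`. -/
theorem IsLocalOrder.symbol_equivariant (hO : IsLocalOrder p N O π) (hpp : p.Prime) (hp : Odd p)
    (hN : 1 ≤ N) (hpow : ∀ u : Fˣ, (∃ α ∈ O, (u : F) = 1 + α * (π : F) ^ (N + 1)) → ∃ w, w ^ p = u)
    (σ : F ≃+* F) (hσ : ∀ α ∈ O, σ α ∈ O) (hσ' : ∀ α ∈ O, ∃ γ ∈ O, σ α = α + γ * π)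
    {ε : Fˣ} (hσπ : σ π = π * ε) (hε : (ε : F) ∈ O) (hε' : ((ε⁻¹ : Fˣ) : F) ∈ O)
    {κ : ℕ} (hεκ : ∃ γ ∈ O, (ε : F) ^ N = κ + γ * π)
    {c : Fˣ →* Fˣ →* Q} (hS : ∀ x y : Fˣ, (x : F) + y = 1 → c x y = 1) (x y : Fˣ) :
    c (Units.map (σ : F →* F) x) (Units.map (σ : F →* F) y) / c x y ^ κ ∈ symbolPowers c p 1 := by
  let s : Fˣ →* Fˣ := Units.map (σ : F →* F)
  have hs : ∀ z : Fˣ, ((s z : Fˣ) : F) = σ z := fun z => rfl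
  let c' : Fˣ →* Fˣ →* Q ⧸ symbolPowers c p 1 := c.compr₂ (QuotientGroup.mk' _)
  have hc' : ∀ x y, c' x y = (c x y : Q ⧸ symbolPowers c p 1) := fun x y => rfl
  have hS' : ∀ x y : Fˣ, (x : F) + y = 1 → c' x y = 1 := fun x y h => by
    rw [hc', hS x y h, QuotientGroup.mk_one]
  have hp' : ∀ x y, c' x y ^ p = 1 := fun x y => by
    rw [hc', ← QuotientGroup.mk_pow, QuotientGroup.eq_one_iff]
    simpa using symbol_pow_mem c p 1 x y
  have htop : ∀ x u : Fˣ, (∃ α ∈ O, (u : F) = 1 + α * (π : F) ^ (N + 1)) → c' x u = 1 := by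
    intro x u hu
    obtain ⟨w, rfl⟩ := hpow u hu
    rw [map_pow, hp']
  have hunit : ∀ v u : Fˣ, (v : F) ∈ O → ((v⁻¹ : Fˣ) : F) ∈ O →
      (∃ α ∈ O, (u : F) = 1 + α * (π : F) ^ N) → c' v u = 1 := fun v u hv hv' hu =>
    hO.symbol_unit_eq_one hS' hp hp' htop hv hv' hu
  let ψ : Fˣ →* Fˣ →* Q ⧸ symbolPowers c p 1 := (c'.comp s).compl₂ s / c' ^ κ
  have hψ : ∀ x y, ψ x y = c' (s x) (s y) / c' x y ^ κ := fun x y => rfl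
  have hsU : ∀ u : Fˣ, (∃ α ∈ O, (u : F) = 1 + α * (π : F) ^ N) →
      ∃ α ∈ O, ((s u : Fˣ) : F) = 1 + α * (π : F) ^ N := by
    rintro u ⟨α, hα, hu⟩
    refine ⟨σ α * (ε : F) ^ N, mul_mem (hσ α hα) (pow_mem hε N), ?_⟩
    rw [hs, hu, map_add, map_one, map_mul, map_pow, hσπ]
    ring
  have hmain : ∀ x y, ψ x y = 1 := by
    refine hO.symbol_eq_one ?_ hp ?_ hpp hN ?_
    · intro x y h
      rw [hψ, hS' x y h, hS' (s x) (s y) (by rw [hs, hs, ← map_add, h, map_one]), one_pow, div_one]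
    · intro x y
      rw [hψ, div_pow, hp', pow_right_comm, hp', one_pow, div_one]
    · intro x u hu
      obtain ⟨k, v, rfl, hv, hv'⟩ := hO.exists_factor x
      have h1 : ψ v u = 1 := by
        rw [hψ, hunit v u hv hv' hu, hunit (s v) (s u) (hσ v hv) ?_ (hsU u hu), one_pow, div_one]
        rw [← map_inv]
        exact hσ _ hv'
      have h2 : ψ π u = 1 := by
        have h3 : s π = π * ε := Units.ext hσπ
        rw [hψ, h3, map_mul, MonoidHom.mul_apply, hunit ε (s u) hε hε' (hsU u hu), mul_one,
          ← map_pow, ← map_div]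
        obtain ⟨α, hα, hu⟩ := hu
        obtain ⟨γ, hγ, hγ'⟩ := hεκ
        obtain ⟨δ, hδ, hδ'⟩ := hσ' α hα
        obtain ⟨w, hw, hw'⟩ := hO.exists_one_add_pow hN hα
        obtain rfl : w = u := Units.ext (hw.trans hu.symm)
        obtain ⟨N, rfl⟩ := Nat.exists_eq_add_of_le hN
        obtain ⟨r, hr⟩ : ∃ r : O, ((⟨α * (π : F) ^ (1 + N),
            mul_mem hα (pow_mem hO.unif_mem _)⟩ : O) + 1) ^ κ = 1 + κ * ⟨α * (π : F) ^ (1 + N),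
            mul_mem hα (pow_mem hO.unif_mem _)⟩ + r * ⟨α * (π : F) ^ (1 + N),
            mul_mem hα (pow_mem hO.unif_mem _)⟩ ^ 2 := by
          obtain ⟨r, hr⟩ := Polynomial.powAddExpansion (1 : O) (⟨α * (π : F) ^ (1 + N),
            mul_mem hα (pow_mem hO.unif_mem _)⟩ : O) κ
          exact ⟨r, by rw [add_comm, hr]; ring⟩
        have hr' := congrArg (Subtype.val) hr
        simp only [Subring.coe_add, Subring.coe_mul, Subring.coe_pow, Subring.coe_one,
          Subring.coe_natCast] at hr'
        apply htop
        have hwO : ((w : Fˣ) : F) ∈ O := by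
          rw [hw]; exact add_mem (one_mem _) (mul_mem hα (pow_mem hO.unif_mem _))
        refine ⟨(α * γ + δ * κ + δ * γ * π - r * α ^ 2 * (π : F) ^ N) * ((w⁻¹ : Fˣ) : F) ^ κ,
          mul_mem ?_ (pow_mem hw' κ), ?_⟩
        · exact sub_mem (add_mem (add_mem (mul_mem hα hγ) (mul_mem hδ (natCast_mem _ _)))
            (mul_mem (mul_mem hδ hγ) hO.unif_mem)) (mul_mem (mul_mem r.2 (pow_mem hα 2))
            (pow_mem hO.unif_mem N))
        · have h5 : ((w⁻¹ : Fˣ) : F) ^ κ * (w : F) ^ κ = 1 := by simp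
          rw [hw] at h5
          rw [add_comm 1 (α * (π : F) ^ (1 + N)), hr'] at h5
          rw [div_eq_mul_inv, Units.val_mul, hs, ← inv_pow, Units.val_pow_eq_pow_val]
          generalize ((w⁻¹ : Fˣ) : F) ^ κ = W at h5 ⊢
          rw [hw, map_add, map_one, map_mul, map_pow, hσπ, mul_pow, hγ', hδ']
          linear_combination h5
      simp [h1, h2]
  have h := hmain x y
  rwa [hψ, hc', hc', ← QuotientGroup.mk_pow, ← QuotientGroup.mk_div, QuotientGroup.eq_one_iff] at h

/-- Descent along the powers of `p`: a symbol which is an eigenvector for an eigenvalue other than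
`κ` modulo `p` is trivial. -/
theorem symbol_eq_one_of_eigen {c : Fˣ →* Fˣ →* Q} {p n : ℕ} (hpp : p.Prime)
    (hc : ∀ x y, c x y ^ p ^ n = 1) {θ : Q →* Q} {κ : ℕ}
    (hθ : ∀ x y, θ (c x y) / c x y ^ κ ∈ symbolPowers c p 1) {a b : Fˣ} {A : ℕ}
    (hA : θ (c a b) = c a b ^ A) (hAκ : (A : ZMod p) ≠ κ) : c a b = 1 := by
  let χ : Q →* Q := θ / powMonoidHom κ
  have hχ : ∀ z, χ z = θ z / z ^ κ := fun z => rfl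
  have h1 : Subgroup.closure {z | ∃ x y, c x y = z} ≤ (symbolPowers c p 1).comap χ := by
    rw [Subgroup.closure_le]
    rintro _ ⟨x, y, rfl⟩
    exact hθ x y
  have h2 : ∀ i, ∀ z ∈ symbolPowers c p i, χ z ∈ symbolPowers c p (i + 1) := by
    rintro i _ ⟨t, ht, rfl⟩
    obtain ⟨w, hw, hw'⟩ := h1 ht
    refine ⟨w, hw, ?_⟩
    simp only [powMonoidHom_apply, pow_one, map_pow] at hw' ⊢
    rw [pow_succ', pow_mul, hw']
  have hcop : IsCoprime ((A : ℤ) - κ) ((p ^ n : ℕ) : ℤ) := by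
    push_cast
    refine IsCoprime.pow_right ?_
    rw [isCoprime_comm, Prime.coprime_iff_not_dvd (Nat.prime_iff_prime_int.1 hpp)]
    intro h
    apply hAκ
    rw [← sub_eq_zero]
    exact_mod_cast (ZMod.intCast_zmod_eq_zero_iff_dvd _ p).2 h
  have h3 : ∀ i, c a b ∈ symbolPowers c p i := by
    intro i
    induction i with
    | zero => simpa using symbol_pow_mem c p 0 a b
    | succ i ih =>
      have h4 := h2 i _ ih
      rw [hχ, hA, ← zpow_natCast, ← zpow_natCast, div_eq_mul_inv, ← zpow_sub] at h4
      obtain ⟨k, l, hkl⟩ := hcop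
      have h5 : c a b = (c a b ^ ((A : ℤ) - κ)) ^ k := by
        have h6 : c a b ^ (k * ((A : ℤ) - κ) + l * ((p ^ n : ℕ) : ℤ)) = c a b := by
          rw [hkl, zpow_one]
        rw [zpow_add, mul_comm l, zpow_mul _ _ l, zpow_natCast, hc, one_zpow, mul_one, mul_comm,
          zpow_mul] at h6
        exact h6.symm
      rw [h5]
      exact zpow_mem h4 k
  obtain ⟨t, ht, ht'⟩ := h3 n
  have h4 : Subgroup.closure {z | ∃ x y, c x y = z} ≤ (powMonoidHom (p ^ n) : Q →* Q).ker := by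
    rw [Subgroup.closure_le]
    rintro _ ⟨x, y, rfl⟩
    exact hc x y
  rw [← ht']
  exact h4 ht

end LocalSymbol

section Compactness

variable {p : ℕ} [Fact p.Prime] {F : Type*} [Field F] [Algebra ℚ_[p] F] [FiniteDimensional ℚ_[p] F]
  (μ : AbsoluteValue F ℝ) (hμ : ∀ x : ℚ_[p], μ (algebraMap ℚ_[p] F x) = ‖x‖)

include hμ

/-- The unit ball of an absolute value extending the `p`-adic one is totally bounded. -/
theorem AbsoluteValue.exists_finset_cover {ε : ℝ} (hε : 0 < ε) :
    ∃ T : Finset F, ∀ x, μ x ≤ 1 → ∃ t ∈ T, μ (x - t) < ε := by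
  let := μ.toNormedField
  let : NormedSpace ℚ_[p] F := ⟨fun a b => by
    rw [Algebra.smul_def, norm_mul]
    exact mul_le_mul_of_nonneg_right (hμ a).le (norm_nonneg _)⟩
  have : ProperSpace F := FiniteDimensional.proper ℚ_[p] F
  obtain ⟨t, -, ht, h⟩ := (isCompact_closedBall (0 : F) 1).finite_cover_balls hε
  refine ⟨ht.toFinset, fun x hx => ?_⟩
  have hx' : x ∈ Metric.closedBall (0 : F) 1 := by
    rw [mem_closedBall_zero_iff]; exact hx
  obtain ⟨s, hs, hxs⟩ := Set.mem_iUnion₂.1 (h hx')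
  exact ⟨s, ht.mem_toFinset.2 hs, by rwa [Metric.mem_ball, dist_eq_norm] at hxs⟩

/-- An element which is approximated arbitrarily well by `m`-th powers of integral elements is an
`m`-th power. -/
theorem AbsoluteValue.exists_pow_eq {m : ℕ} {u : F}
    (h : ∀ ε > 0, ∃ w, μ w ≤ 1 ∧ μ (w ^ m - u) < ε) : ∃ w, w ^ m = u := by
  let := μ.toNormedField
  let : NormedSpace ℚ_[p] F := ⟨fun a b => by
    rw [Algebra.smul_def, norm_mul]
    exact mul_le_mul_of_nonneg_right (hμ a).le (norm_nonneg _)⟩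
  have : ProperSpace F := FiniteDimensional.proper ℚ_[p] F
  have hc : IsClosed ((fun w : F => w ^ m) '' Metric.closedBall 0 1) :=
    ((isCompact_closedBall (0 : F) 1).image (by fun_prop)).isClosed
  have hu : u ∈ closure ((fun w : F => w ^ m) '' Metric.closedBall 0 1) := by
    rw [Metric.mem_closure_iff]
    intro ε hε
    obtain ⟨w, hw, hw'⟩ := h ε hε
    refine ⟨w ^ m, ⟨w, ?_, rfl⟩, ?_⟩
    · rw [mem_closedBall_zero_iff]; exact hw
    · rw [dist_comm, dist_eq_norm]; exact hw'
  rw [hc.closure_eq] at hu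
  obtain ⟨w, -, hw⟩ := hu
  exact ⟨w, hw⟩

end Compactness

section Order

theorem exists_sq_eq_one_add_mul_sq {p : ℕ} [Fact p.Prime] (hp : Odd p) (x : ℤ_[p]) :
    ∃ y : ℤ_[p], y ^ 2 = 1 + p * x ^ 2 := by
  have h2 : ‖(2 : ℤ_[p])‖ = 1 := by
    have : ((2 : ℕ) : ℤ_[p]) = 2 := by norm_num
    rw [← this, PadicInt.norm_natCast_eq_one_iff]
    exact (Nat.coprime_primes Fact.out Nat.prime_two).2 (by rintro rfl; exact absurd hp (by decide))
  obtain ⟨c, hc⟩ : ∃ c : ℤ_[p], c = 1 + p * x ^ 2 := ⟨_, rfl⟩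
  let f : Polynomial ℤ_[p] := Polynomial.X ^ 2 - Polynomial.C c
  obtain ⟨z, hz, -⟩ := hensels_lemma (F := f) (a := (1 : ℤ_[p])) (by
    have h3 : f.aeval (1 : ℤ_[p]) = -(p * x ^ 2) := by simp [f, hc]
    have h4 : f.derivative.aeval (1 : ℤ_[p]) = 2 := by simp [f, one_add_one_eq_two]
    rw [h3, h4, h2, norm_neg, one_pow, PadicInt.norm_lt_one_iff_dvd]
    exact dvd_mul_right _ _)
  exact ⟨z, by simpa [f, sub_eq_zero, hc] using hz⟩

variable {F : Type*} [Field F] (v : AddValuation F (WithTop ℤ))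

namespace AddValuation

theorem exists_int_eq {x : F} (hx : x ≠ 0) : ∃ k : ℤ, v x = k := by
  obtain ⟨k, hk⟩ := WithTop.ne_top_iff_exists.1 ((v.ne_top_iff).2 hx)
  exact ⟨k, hk.symm⟩

theorem map_inv_of_eq {x : F} {k : ℤ} (h : v x = k) : v x⁻¹ = (-k : ℤ) := by
  rw [AddValuation.map_inv, h]
  rfl

theorem map_pow_of_eq {x : F} {k : ℤ} (h : v x = k) (j : ℕ) : v (x ^ j) = (j * k : ℤ) := by
  rw [AddValuation.map_pow, h, ← WithTop.coe_nsmul, nsmul_eq_mul]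

theorem map_zpow_of_eq {x : F} {k : ℤ} (h : v x = k) (j : ℤ) : v (x ^ j) = (j * k : ℤ) := by
  obtain ⟨l, rfl | rfl⟩ := j.eq_nat_or_neg
  · rw [zpow_natCast, v.map_pow_of_eq h]
  · rw [zpow_neg, zpow_natCast, v.map_inv_of_eq (v.map_pow_of_eq h l), neg_mul]

theorem map_mul_of_eq {x y : F} {k l : ℤ} (hx : v x = k) (hy : v y = l) :
    v (x * y) = (k + l : ℤ) := by
  rw [AddValuation.map_mul, hx, hy, WithTop.coe_add]

theorem ne_zero_of_eq {x : F} {k : ℤ} (h : v x = k) : x ≠ 0 :=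
  (v.ne_top_iff).1 (h ▸ WithTop.coe_ne_top)

/-- The ring of integers of an additive valuation. -/
def orderRing : Subring F where
  carrier := {x | 0 ≤ v x}
  mul_mem' {x y} hx hy := by
    rw [Set.mem_ofPred_eq, AddValuation.map_mul]; exact add_nonneg hx hy
  one_mem' := by rw [Set.mem_ofPred_eq, AddValuation.map_one]
  add_mem' hx hy := v.map_le_add hx hy
  zero_mem' := by rw [Set.mem_ofPred_eq, AddValuation.map_zero]; exact le_top
  neg_mem' {x} hx := by rw [Set.mem_ofPred_eq, AddValuation.map_neg]; exact hx

theorem mem_orderRing {x : F} : x ∈ v.orderRing ↔ 0 ≤ v x := Iff.rfl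

theorem le_iff_exists_mul_zpow {π : F} (hπ : v π = (1 : ℤ)) (k : ℤ) {x : F} :
    (k : WithTop ℤ) ≤ v x ↔ ∃ γ ∈ v.orderRing, x = γ * π ^ k := by
  have hk : v (π ^ k) = (k : ℤ) := by rw [v.map_zpow_of_eq hπ, mul_one]
  constructor
  · intro h
    refine ⟨x * π ^ (-k), ?_, ?_⟩
    · rw [mem_orderRing, AddValuation.map_mul, v.map_zpow_of_eq hπ, mul_one]
      calc (0 : WithTop ℤ) = (k : WithTop ℤ) + ((-k : ℤ) : WithTop ℤ) := by
            rw [← WithTop.coe_add, add_neg_cancel]; rfl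
        _ ≤ _ := add_le_add_left h _
    · rw [mul_assoc, ← zpow_add₀ (v.ne_zero_of_eq hπ), neg_add_cancel, zpow_zero, mul_one]
  · rintro ⟨γ, hγ, rfl⟩
    rw [AddValuation.map_mul, hk]
    exact le_add_of_nonneg_left hγ

theorem le_iff_exists_mul_pow {π : F} (hπ : v π = (1 : ℤ)) (k : ℕ) {x : F} :
    ((k : ℤ) : WithTop ℤ) ≤ v x ↔ ∃ γ ∈ v.orderRing, x = γ * π ^ k := by
  simpa using v.le_iff_exists_mul_zpow hπ k (x := x)

theorem eq_iff_exists_mul_zpow {π : F} (hπ : v π = (1 : ℤ)) (k : ℤ) {x : F} :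
    v x = k ↔ ∃ u : F, v u = (0 : ℤ) ∧ x = u * π ^ k := by
  have hk : v (π ^ k) = (k : ℤ) := by rw [v.map_zpow_of_eq hπ, mul_one]
  constructor
  · intro h
    refine ⟨x * π ^ (-k), ?_, ?_⟩
    · rw [v.map_mul_of_eq h (v.map_zpow_of_eq hπ (-k))]
      congr 1; ring
    · rw [mul_assoc, ← zpow_add₀ (v.ne_zero_of_eq hπ), neg_add_cancel, zpow_zero, mul_one]
  · rintro ⟨γ, hγ, rfl⟩
    rw [v.map_mul_of_eq hγ hk, zero_add]

/-- The absolute value `x ↦ q ^ (-v x / e)` attached to an additive valuation. -/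
noncomputable def toAbsoluteValue {q : ℝ} (hq : 1 < q) {e : ℤ} (he : 0 < e) : AbsoluteValue F ℝ where
  toFun x := (v x).recTopCoe 0 fun k => q ^ (-(k : ℝ) / e)
  map_mul' x y := by
    cases hx : v x <;> cases hy : v y <;> simp [AddValuation.map_mul, hx, hy]
    rename_i a b
    change q ^ (-((a + b : ℤ) : ℝ) / e) = _
    rw [← Real.rpow_add (by linarith)]
    congr 1; push_cast; ring
  nonneg' x := by
    cases hx : v x <;> simp
    positivity
  eq_zero' x := by
    rw [← v.top_iff]
    cases hx : v x <;> simp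
    positivity
  add_le' x y := by
    have he' : (0 : ℝ) < e := by exact_mod_cast he
    have hmono : Antitone fun a : WithTop ℤ =>
        (a.recTopCoe 0 fun k => q ^ (-(k : ℝ) / e) : ℝ) := by
      intro a b hab
      cases a <;> cases b
      · simp
      · simp at hab
      · simp; positivity
      · simp only [WithTop.recTopCoe_coe]
        refine Real.rpow_le_rpow_of_exponent_le hq.le ?_
        have : (_ : ℤ) ≤ _ := WithTop.coe_le_coe.1 hab
        gcongr
    have hnn : ∀ a : WithTop ℤ, 0 ≤ (a.recTopCoe 0 fun k => q ^ (-(k : ℝ) / e) : ℝ) := by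
      intro a
      cases a <;> simp
      positivity
    rcases v.map_add' x y with h | h
    · exact (hmono h).trans (le_add_of_nonneg_right (hnn _))
    · exact (hmono h).trans (le_add_of_nonneg_left (hnn _))

theorem toAbsoluteValue_of_eq {q : ℝ} (hq : 1 < q) {e : ℤ} (he : 0 < e) {x : F} {k : ℤ}
    (h : v x = k) : v.toAbsoluteValue hq he x = q ^ (-(k : ℝ) / e) := by
  have h1 : v.toAbsoluteValue hq he x = ((v x).recTopCoe 0 fun k => q ^ (-(k : ℝ) / e) : ℝ) := rfl
  rw [h1, h]
  rfl

theorem toAbsoluteValue_le_iff {q : ℝ} (hq : 1 < q) {e : ℤ} (he : 0 < e) {x : F} {k : ℤ} :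
    v.toAbsoluteValue hq he x ≤ q ^ (-(k : ℝ) / e) ↔ (k : WithTop ℤ) ≤ v x := by
  have he' : (0 : ℝ) < e := by exact_mod_cast he
  rcases eq_or_ne x 0 with rfl | hx
  · simp only [AddValuation.map_zero, le_top, iff_true, _root_.map_zero]
    exact Real.rpow_nonneg (by linarith) _
  · obtain ⟨l, hl⟩ := v.exists_int_eq hx
    rw [v.toAbsoluteValue_of_eq hq he hl, hl, Real.rpow_le_rpow_left_iff hq, WithTop.coe_le_coe,
      div_le_div_iff_of_pos_right he', neg_le_neg_iff, Int.cast_le]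

end AddValuation

end Order

section LocalField

variable {p : ℕ} [Fact p.Prime] {F : Type*} [Field F] [Algebra ℚ_[p] F]
  (v : AddValuation F (WithTop ℤ))

theorem exists_one_add_pow_prime_eq {R : Type*} [CommRing R] {p : ℕ} (hp : p.Prime) (z : R) :
    ∃ r : R, (1 + z) ^ p = 1 + p * z + p * (z * z) * r + z ^ p := by
  have h1 := add_pow_prime_eq hp z 1
  rw [← Finset.add_sum_erase _ _ (Finset.mem_Ioo.2 ⟨zero_lt_one, hp.one_lt⟩)] at h1
  have h2 : z ∣ ∑ k ∈ (Finset.Ioo 0 p).erase 1,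
      z ^ (k - 1) * 1 ^ (p - k - 1) * ((p.choose k / p : ℕ) : R) := by
    refine Finset.dvd_sum fun k hk => ?_
    rw [Finset.mem_erase, Finset.mem_Ioo] at hk
    exact ((dvd_pow_self z (by omega)).mul_right _).mul_right _
  obtain ⟨r, hr⟩ := h2
  refine ⟨r, ?_⟩
  rw [hr] at h1
  simp only [Nat.choose_one_right, Nat.div_self hp.pos, one_pow, Nat.sub_self, pow_zero,
    Nat.cast_one] at h1
  linear_combination h1

namespace AddValuation

/-- An additive valuation on an extension of `ℚ_[p]` whose values on `ℚ_[p]` are multiples of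
`v p` extends the `p`-adic valuation. -/
theorem map_algebraMap_padic (hp : Odd p) {e : ℤ} (he : 0 < e) (hvp : v (p : F) = e)
    (h : ∀ x : ℚ_[p], x ≠ 0 → ∃ k : ℤ, v (algebraMap ℚ_[p] F x) = (e * k : ℤ)) {x : ℚ_[p]}
    (hx : x ≠ 0) : v (algebraMap ℚ_[p] F x) = (e * x.valuation : ℤ) := by
  have hintegral : ∀ z : ℤ_[p], 0 ≤ v (algebraMap ℚ_[p] F z) := by
    intro z
    rcases eq_or_ne z 0 with rfl | hz
    · simp
    by_contra hneg
    obtain ⟨k, hk⟩ := h z (by simpa using hz)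
    have hk0 : e * k < 0 := by
      rw [hk, not_le] at hneg
      exact_mod_cast hneg
    have hk1 : k < 0 := by nlinarith
    obtain ⟨y, hy⟩ := exists_sq_eq_one_add_mul_sq hp z
    have hy' : (algebraMap ℚ_[p] F y) ^ 2 = 1 + p * (algebraMap ℚ_[p] F z) ^ 2 := by
      have := congrArg (fun t : ℤ_[p] => algebraMap ℚ_[p] F t) hy
      simpa using this
    have h1 : v ((p : F) * (algebraMap ℚ_[p] F z) ^ 2) = (e + (2 : ℕ) * (e * k) : ℤ) :=
      v.map_mul_of_eq hvp (v.map_pow_of_eq hk 2)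
    have h2 : v (1 + (p : F) * (algebraMap ℚ_[p] F z) ^ 2) = (e + (2 : ℕ) * (e * k) : ℤ) := by
      rw [v.map_add_eq_of_lt_right, h1]
      rw [h1, AddValuation.map_one]
      have : e + (2 : ℕ) * (e * k) < 0 := by push_cast; nlinarith
      exact_mod_cast this
    have hy0 : y ≠ 0 := by
      rintro rfl
      refine v.ne_zero_of_eq h2 ?_
      rw [← hy']
      simp
    obtain ⟨l, hl⟩ := h y (by simpa using hy0)
    rw [← hy', v.map_pow_of_eq hl, WithTop.coe_inj] at h2
    push_cast at h2
    have h3 : 2 * l = 1 + 2 * k := by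
      have : e * (2 * l) = e * (1 + 2 * k) := by linarith
      exact mul_left_cancel₀ he.ne' this
    omega
  have hunit : ∀ z : ℚ_[p], ‖z‖ = 1 → v (algebraMap ℚ_[p] F z) = (0 : ℤ) := by
    intro z hz
    have hz0 : z ≠ 0 := by rintro rfl; simp at hz
    have h1 := hintegral ⟨z, hz.le⟩
    have h2 := hintegral ⟨z⁻¹, by rw [norm_inv, hz, inv_one]⟩
    obtain ⟨k, hk⟩ := h z hz0
    simp only [map_inv₀] at h1 h2
    rw [v.map_inv_of_eq hk] at h2
    rw [hk] at h1 ⊢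
    have h1' : 0 ≤ e * k := by exact_mod_cast h1
    have h2' : 0 ≤ -(e * k) := by exact_mod_cast h2
    congr 1
    omega
  have hx' : x = x * (p : ℚ_[p]) ^ (-x.valuation) * (p : ℚ_[p]) ^ x.valuation := by
    rw [mul_assoc, ← zpow_add₀ (by exact_mod_cast (Fact.out : p.Prime).ne_zero), neg_add_cancel,
      zpow_zero, mul_one]
  have h1 : ‖x * (p : ℚ_[p]) ^ (-x.valuation)‖ = 1 := by
    rw [norm_mul, Padic.norm_eq_zpow_neg_valuation hx, Padic.norm_p_zpow, neg_neg,
      ← zpow_add₀ (by exact_mod_cast (Fact.out : p.Prime).ne_zero), neg_add_cancel, zpow_zero]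
  have h2 : algebraMap ℚ_[p] F x = algebraMap ℚ_[p] F (x * (p : ℚ_[p]) ^ (-x.valuation)) *
      (p : F) ^ x.valuation := by
    conv_lhs => rw [hx']
    rw [_root_.map_mul, map_zpow₀, map_natCast]
  rw [h2, v.map_mul_of_eq (hunit _ h1) (v.map_zpow_of_eq hvp _)]
  congr 1
  ring

variable [FiniteDimensional ℚ_[p] F] {e : ℤ} (he : 0 < e)
  (hv : ∀ x : ℚ_[p], x ≠ 0 → v (algebraMap ℚ_[p] F x) = (e * x.valuation : ℤ))

include he hv

omit [FiniteDimensional ℚ_[p] F] in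
theorem toAbsoluteValue_algebraMap_padic (hp1 : (1 : ℝ) < p) (x : ℚ_[p]) :
    v.toAbsoluteValue hp1 he (algebraMap ℚ_[p] F x) = ‖x‖ := by
  rcases eq_or_ne x 0 with rfl | hx
  · simp
  · have he' : (e : ℝ) ≠ 0 := by exact_mod_cast he.ne'
    rw [v.toAbsoluteValue_of_eq hp1 he (hv x hx), Padic.norm_eq_zpow_neg_valuation hx,
      ← Real.rpow_intCast]
    congr 1
    push_cast
    field_simp

theorem exists_finset_cover (K : ℤ) :
    ∃ T : Finset F, ∀ x ∈ v.orderRing, ∃ t ∈ T, (K : WithTop ℤ) ≤ v (x - t) := by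
  have hp1 : (1 : ℝ) < p := by exact_mod_cast (Fact.out : p.Prime).one_lt
  obtain ⟨T, hT⟩ := (v.toAbsoluteValue hp1 he).exists_finset_cover
    (v.toAbsoluteValue_algebraMap_padic he hv hp1) (ε := (p : ℝ) ^ (-(K : ℝ) / e)) (by positivity)
  refine ⟨T, fun x hx => ?_⟩
  obtain ⟨t, ht, h⟩ := hT x (by simpa using (v.toAbsoluteValue_le_iff hp1 he (k := 0)).2 hx)
  exact ⟨t, ht, (v.toAbsoluteValue_le_iff hp1 he).1 h.le⟩

theorem exists_pow_eq_of_approx {m : ℕ} {u : F}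
    (h : ∀ K : ℕ, ∃ w ∈ v.orderRing, ((K : ℤ) : WithTop ℤ) ≤ v (w ^ m - u)) : ∃ w, w ^ m = u := by
  have hp1 : (1 : ℝ) < p := by exact_mod_cast (Fact.out : p.Prime).one_lt
  refine (v.toAbsoluteValue hp1 he).exists_pow_eq
    (v.toAbsoluteValue_algebraMap_padic he hv hp1) (fun ε hε => ?_)
  obtain ⟨j, hj⟩ := exists_pow_lt_of_lt_one hε (inv_lt_one_of_one_lt₀ hp1)
  obtain ⟨w, hw, hwu⟩ := h (e.toNat * j)
  refine ⟨w, by simpa using (v.toAbsoluteValue_le_iff hp1 he (k := 0)).2 hw, ?_⟩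
  refine ((v.toAbsoluteValue_le_iff hp1 he).2 hwu).trans_lt (lt_of_eq_of_lt ?_ hj)
  have he' : (e : ℝ) ≠ 0 := by exact_mod_cast he.ne'
  have h1 : (((e.toNat * j : ℕ) : ℤ) : ℝ) = e * j := by
    push_cast [Int.toNat_of_nonneg he.le]; rfl
  rw [h1, ← Real.rpow_natCast, Real.inv_rpow (by linarith), ← Real.rpow_neg (by linarith)]
  congr 1
  field_simp

omit [FiniteDimensional ℚ_[p] F] he hv in
theorem exists_units_of_eq_zero {x : F} (hx : v x = (0 : ℤ)) :
    ∃ u : Fˣ, (u : F) = x ∧ ((u⁻¹ : Fˣ) : F) ∈ v.orderRing := by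
  refine ⟨Units.mk0 x (v.ne_zero_of_eq hx), rfl, ?_⟩
  rw [Units.val_inv_eq_inv_val, Units.val_mk0, mem_orderRing, v.map_inv_of_eq hx]
  exact le_rfl

omit [Fact p.Prime] [Algebra ℚ_[p] F] [FiniteDimensional ℚ_[p] F] he hv in
theorem map_one_add_of_pos {y : F} (hy : (1 : ℤ) ≤ v y) : v (1 + y) = (0 : ℤ) := by
  rw [v.map_add_eq_of_lt_left, AddValuation.map_one]
  · rfl
  · rw [AddValuation.map_one]
    exact lt_of_lt_of_le (by exact_mod_cast zero_lt_one) hy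

omit [Algebra ℚ_[p] F] [FiniteDimensional ℚ_[p] F] hv in
theorem one_le_of_one_le_pow_sub (hvp : v (p : F) = e) {x y : F} (hx : x ∈ v.orderRing)
    (hy : y ∈ v.orderRing) (h : (1 : ℤ) ≤ v (x ^ p - y ^ p)) : (1 : ℤ) ≤ v (x - y) := by
  obtain ⟨r, hr⟩ := exists_add_pow_prime_eq (Fact.out : p.Prime) (⟨x - y, sub_mem hx hy⟩ : v.orderRing)
    ⟨y, hy⟩
  have hr' := congrArg Subtype.val hr
  simp only [Subring.coe_add, Subring.coe_mul, Subring.coe_pow, Subring.coe_natCast,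
    sub_add_cancel] at hr'
  have h1 : (x - y) ^ p = x ^ p - y ^ p - p * ((x - y) * y * r) := by linear_combination -hr'
  have h2 : ((1 : ℤ) : WithTop ℤ) ≤ v ((x - y) ^ p) := by
    rw [h1]
    refine v.map_le_sub h ?_
    rw [AddValuation.map_mul, hvp]
    refine le_add_of_le_of_nonneg ?_ (mul_mem (mul_mem (sub_mem hx hy) hy) r.2)
    exact_mod_cast he
  rcases eq_or_ne (x - y) 0 with h0 | h0
  · rw [h0]; simp
  obtain ⟨k, hk⟩ := v.exists_int_eq h0
  rw [v.map_pow_of_eq hk] at h2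
  rw [hk]
  have h3 : (1 : ℤ) ≤ p * k := by exact_mod_cast h2
  have h4 : (0 : ℤ) ≤ p := Int.natCast_nonneg p
  have : 1 ≤ k := by by_contra hlt; nlinarith
  exact_mod_cast this

theorem exists_pth_root_mod (hvp : v (p : F) = e) {α : F} (hα : α ∈ v.orderRing) :
    ∃ β ∈ v.orderRing, (1 : ℤ) ≤ v (α - β ^ p) := by
  obtain ⟨T, hT⟩ := v.exists_finset_cover he hv 1
  choose! t ht ht' using hT
  obtain ⟨i, j, hij, h⟩ := Finite.exists_ne_map_eq_of_infinite
    (fun k : ℕ => (⟨t (α ^ p ^ k), ht _ (pow_mem hα _)⟩ : T))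
  wlog hlt : i < j generalizing i j
  · exact this j i hij.symm h.symm (by omega)
  have h1 : ((1 : ℤ) : WithTop ℤ) ≤ v (α ^ p ^ i - α ^ p ^ j) := by
    have h2 := v.map_le_sub (ht' _ (pow_mem hα (p ^ i))) (ht' _ (pow_mem hα (p ^ j)))
    rwa [show t (α ^ p ^ i) = t (α ^ p ^ j) from congrArg Subtype.val h, sub_sub_sub_cancel_right]
      at h2
  obtain ⟨d, rfl⟩ : ∃ d, j = i + (d + 1) := ⟨j - i - 1, by omega⟩
  have h2 : ∀ i, ((1 : ℤ) : WithTop ℤ) ≤ v (α ^ p ^ i - α ^ p ^ (i + (d + 1))) →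
      ((1 : ℤ) : WithTop ℤ) ≤ v (α - α ^ p ^ (d + 1)) := by
    intro i
    induction i with
    | zero => intro h; simpa using h
    | succ i ih =>
      intro h
      refine ih (v.one_le_of_one_le_pow_sub he hvp (pow_mem hα _) (pow_mem hα _) ?_)
      rwa [← pow_mul, ← pow_mul, ← pow_succ, ← pow_succ, add_right_comm]
  refine ⟨α ^ p ^ d, pow_mem hα _, ?_⟩
  rw [← pow_mul, ← pow_succ]
  exact h2 i h1

theorem isLocalOrder (hvp : v (p : F) = e) {π : Fˣ} (hπ : v (π : F) = (1 : ℤ)) {N : ℕ}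
    (hN : (N : ℤ) * (p - 1) = p * e) : IsLocalOrder p N v.orderRing π where
  unif_mem := by
    rw [mem_orderRing, hπ]
    exact_mod_cast zero_le_one
  exists_factor x := by
    obtain ⟨k, hk⟩ := v.exists_int_eq x.ne_zero
    obtain ⟨u, hu, hx⟩ := (v.eq_iff_exists_mul_zpow hπ k).1 hk
    obtain ⟨w, rfl, hw⟩ := v.exists_units_of_eq_zero hu
    exact ⟨k, w, Units.ext (by simp [hx, mul_comm]), hu.ge, hw⟩
  exists_one_add α hα := v.exists_units_of_eq_zero
    (v.map_one_add_of_pos (by simpa using (v.le_iff_exists_mul_pow hπ 1).2 ⟨α, hα, rfl⟩))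
  unit_or_dvd α hα := by
    by_cases h : ((1 : ℤ) : WithTop ℤ) ≤ v α
    · right
      simpa using (v.le_iff_exists_mul_pow hπ 1).1 (by simpa using h)
    · left
      have h0 : α ≠ 0 := by rintro rfl; simp at h
      obtain ⟨k, hk⟩ := v.exists_int_eq h0
      apply v.exists_units_of_eq_zero
      rw [mem_orderRing, hk] at hα
      rw [hk] at h ⊢
      have h1 : 0 ≤ k := by exact_mod_cast hα
      have h2 : ¬ 1 ≤ k := by exact_mod_cast h
      congr 1
      omega
  exists_pth_root α hα := by
    obtain ⟨β, hβ, h⟩ := v.exists_pth_root_mod he hv hvp hα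
    obtain ⟨γ, hγ, h'⟩ := (v.le_iff_exists_mul_pow hπ 1).1 (by simpa using h)
    exact ⟨β, hβ, γ, hγ, by linear_combination h'⟩
  prime_mul j hj hjN := by
    rw [← v.le_iff_exists_mul_pow hπ, v.map_mul_of_eq hvp (v.map_pow_of_eq hπ j)]
    have h1 : (p : ℤ) * j < N := by exact_mod_cast hjN
    have h2 : (2 : ℤ) ≤ p := by exact_mod_cast (Fact.out : p.Prime).two_le
    have h3 : (p : ℤ) * ((p - 1) * j) < p * e := by nlinarith
    have h4 : ((p : ℤ) - 1) * j < e := lt_of_mul_lt_mul_left h3 (by omega)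
    have h5 : ((p * j + 1 : ℕ) : ℤ) ≤ e + j * 1 := by push_cast; linarith
    exact_mod_cast h5

theorem exists_pow_eq_one_add (hvp : v (p : F) = e) {π : Fˣ} (hπ : v (π : F) = (1 : ℤ)) {N : ℕ}
    (hN : (N : ℤ) * (p - 1) = p * e) {u : Fˣ}
    (hu : ∃ α ∈ v.orderRing, (u : F) = 1 + α * (π : F) ^ (N + 1)) : ∃ w, w ^ p = u := by
  have hp2 : (2 : ℤ) ≤ p := by exact_mod_cast (Fact.out : p.Prime).two_le
  have hp0 : (p : F) ≠ 0 := v.ne_zero_of_eq hvp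
  have hNe : e < N := by
    have h1 : (p : ℤ) * e = N * p - N := by rw [← hN]; ring
    by_contra hle
    have h2 : (N : ℤ) * p ≤ e * p := mul_le_mul_of_nonneg_right (by omega) (by omega)
    have h3 : (N : ℤ) ≤ 0 := by linarith
    have h4 : (N : ℤ) * p ≤ 0 := mul_nonpos_of_nonpos_of_nonneg h3 (by omega)
    have h5 : 0 < (p : ℤ) * e := mul_pos (by omega) he
    omega
  have hu' : ((N + 1 : ℤ) : WithTop ℤ) ≤ v ((u : F) - 1) := by
    obtain ⟨α, hα, hu⟩ := hu
    have := (v.le_iff_exists_mul_pow hπ (N + 1) (x := (u : F) - 1)).2 ⟨α, hα, by rw [hu]; ring⟩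
    simpa using this
  have happrox : ∀ K : ℕ, ∃ w : F, v w = (0 : ℤ) ∧ ((N + 1 + K : ℤ) : WithTop ℤ) ≤ v (u - w ^ p) := by
    intro K
    induction K with
    | zero => exact ⟨1, by rw [AddValuation.map_one]; rfl, by simpa using hu'⟩
    | succ K ih =>
      obtain ⟨w, hw, h⟩ := ih
      have hw0 := v.ne_zero_of_eq hw
      let z := (u - w ^ p) / w ^ p / p
      have hz : ((N + 1 + K - e : ℤ) : WithTop ℤ) ≤ v z := by
        have h1 : v (w ^ p)⁻¹ = (0 : ℤ) := by
          rw [v.map_inv_of_eq (v.map_pow_of_eq hw p)]; simp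
        simp only [z, div_eq_mul_inv, AddValuation.map_mul, h1, v.map_inv_of_eq hvp]
        rw [sub_eq_add_neg, WithTop.coe_add, WithTop.coe_zero, add_zero]
        exact add_le_add_left h _
      have hzO : z ∈ v.orderRing := by
        refine le_trans ?_ hz
        have : (0 : ℤ) ≤ N + 1 + K - e := by omega
        exact_mod_cast this
      obtain ⟨r, hr⟩ := exists_one_add_pow_prime_eq (Fact.out : p.Prime) (⟨z, hzO⟩ : v.orderRing)
      have hr' := congrArg Subtype.val hr
      simp only [Subring.coe_add, Subring.coe_mul, Subring.coe_pow, Subring.coe_natCast,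
        Subring.coe_one] at hr'
      have hz1 : ((1 : ℤ) : WithTop ℤ) ≤ v z := by
        refine le_trans ?_ hz
        have : (1 : ℤ) ≤ N + 1 + K - e := by omega
        exact_mod_cast this
      refine ⟨w * (1 + z), ?_, ?_⟩
      · rw [v.map_mul_of_eq hw (v.map_one_add_of_pos hz1), add_zero]
      · have h1 : w ^ p * (p * z) = u - w ^ p := by
          simp only [z]
          field_simp
        have h2 : u - (w * (1 + z)) ^ p = -(w ^ p * (p * (z * z) * r + z ^ p)) := by
          rw [mul_pow, hr']
          linear_combination -h1
        have hw' : v (w ^ p) = 0 := by rw [v.map_pow_of_eq hw p]; simp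
        rw [h2, AddValuation.map_neg, AddValuation.map_mul, hw', zero_add]
        refine v.map_le_add ?_ ?_
        · rw [AddValuation.map_mul, AddValuation.map_mul, AddValuation.map_mul, hvp]
          refine le_add_of_le_of_nonneg (le_trans ?_ (add_le_add le_rfl (add_le_add hz hz))) r.2
          have : (N + 1 + (K + 1 : ℕ) : ℤ) ≤ e + ((N + 1 + K - e) + (N + 1 + K - e)) := by
            push_cast; omega
          exact_mod_cast this
        · rw [AddValuation.map_pow]
          refine le_trans ?_ (nsmul_le_nsmul_right hz p)
          rw [← WithTop.coe_nsmul, nsmul_eq_mul, WithTop.coe_le_coe]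
          push_cast
          have h3 : (0 : ℤ) ≤ (p - 2) * K := mul_nonneg (by omega) (by omega)
          nlinarith
  suffices h : ∃ w : F, w ^ p = u by
    obtain ⟨w, hw⟩ := h
    have hw0 : w ≠ 0 := by
      rintro rfl
      rw [zero_pow (Fact.out : p.Prime).ne_zero] at hw
      exact u.ne_zero hw.symm
    exact ⟨Units.mk0 w hw0, Units.ext (by simpa using hw)⟩
  refine v.exists_pow_eq_of_approx he hv fun K => ?_
  obtain ⟨w, hw, h⟩ := happrox K
  refine ⟨w, hw.ge, ?_⟩
  rw [AddValuation.map_sub_swap]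
  refine le_trans ?_ h
  have : (K : ℤ) ≤ N + 1 + K := by omega
  exact_mod_cast this

/-- The group of units modulo `p`-th powers is finite. -/
theorem exists_finite_mod_prime_pow (hvp : v (p : F) = e) {π : Fˣ} (hπ : v (π : F) = (1 : ℤ)) {N : ℕ}
    (hN : (N : ℤ) * (p - 1) = p * e) :
    ∃ S : Set Fˣ, S.Finite ∧ ∀ x : Fˣ, ∃ s ∈ S, ∃ w : Fˣ, x = s * w ^ p := by
  have hO := v.isLocalOrder he hv hvp hπ hN
  have hp0 : (p : ℤ) ≠ 0 := by exact_mod_cast (Fact.out : p.Prime).ne_zero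
  obtain ⟨T, hT⟩ := v.exists_finset_cover he hv (N + 1 : ℕ)
  classical
  let rep : F → Fˣ := fun t => if h : ∃ u : Fˣ, (u : F) ∈ v.orderRing ∧
    ((u⁻¹ : Fˣ) : F) ∈ v.orderRing ∧ (((N + 1 : ℕ) : ℤ) : WithTop ℤ) ≤ v (u - t) then h.choose else 1
  refine ⟨Set.image2 (fun k t => π ^ k * rep t) (Set.Ico (0 : ℤ) p) T,
    (Set.finite_Ico _ _).image2 _ T.finite_toSet, fun x => ?_⟩
  obtain ⟨k, u, rfl, hu, hu'⟩ := hO.exists_factor x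
  obtain ⟨t, ht, hut⟩ := hT u hu
  have hex : ∃ u : Fˣ, (u : F) ∈ v.orderRing ∧
    ((u⁻¹ : Fˣ) : F) ∈ v.orderRing ∧ (((N + 1 : ℕ) : ℤ) : WithTop ℤ) ≤ v (u - t) := ⟨u, hu, hu', hut⟩
  have hrep : rep t = hex.choose := dif_pos hex
  obtain ⟨h1, h2, h3⟩ := hex.choose_spec
  rw [← hrep] at h1 h2 h3
  have h4 := v.map_le_sub hut h3
  rw [sub_sub_sub_cancel_right] at h4
  obtain ⟨γ, hγ, h5⟩ := (v.le_iff_exists_mul_pow hπ (N + 1)).1 h4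
  obtain ⟨w, hw⟩ := v.exists_pow_eq_one_add he hv hvp hπ hN (u := (rep t)⁻¹ * u)
    ⟨γ * ((rep t)⁻¹ : Fˣ), mul_mem hγ h2, by
      have h6 : (((rep t)⁻¹ : Fˣ) : F) * rep t = 1 := by simp
      rw [Units.val_mul]
      linear_combination h6 + (((rep t)⁻¹ : Fˣ) : F) * h5⟩
  refine ⟨_, ⟨k % p, ⟨Int.emod_nonneg _ hp0, Int.emod_lt_of_pos _ (by omega)⟩, t, ht, rfl⟩,
    π ^ (k / p) * w, ?_⟩
  rw [mul_pow, hw, ← zpow_natCast, ← zpow_mul]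
  conv_lhs => rw [← Int.emod_add_mul_ediv k p, zpow_add, mul_comm (p : ℤ)]
  dsimp only
  rw [mul_assoc, mul_assoc]
  congr 1
  rw [mul_left_comm, mul_inv_cancel_left]

end AddValuation

/-- If `G / G ^ p` is finite then so is `G / G ^ (p ^ n)`. -/
theorem exists_finite_mod_pow {G : Type*} [CommGroup G] {p : ℕ}
    (h : ∃ S : Set G, S.Finite ∧ ∀ x : G, ∃ s ∈ S, ∃ w : G, x = s * w ^ p) (n : ℕ) :
    ∃ S : Set G, S.Finite ∧ ∀ x : G, ∃ s ∈ S, ∃ w : G, x = s * w ^ p ^ n := by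
  obtain ⟨S, hS, hS'⟩ := h
  induction n with
  | zero => exact ⟨{1}, Set.finite_singleton 1, fun x => ⟨1, rfl, x, by simp⟩⟩
  | succ n ih =>
    obtain ⟨T, hT, hT'⟩ := ih
    refine ⟨Set.image2 (fun s t => s * t ^ p) S T, hS.image2 _ hT, fun x => ?_⟩
    obtain ⟨s, hs, w, rfl⟩ := hS' x
    obtain ⟨t, ht, z, rfl⟩ := hT' w
    exact ⟨_, ⟨s, hs, t, ht, rfl⟩, z, by rw [mul_pow, ← pow_mul, ← pow_succ, mul_assoc]⟩

end LocalField

section EisensteinExtension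

open Polynomial

variable {E F : Type*} [Field E] [Field F] [Algebra E F] {v : AddValuation F (WithTop ℤ)} {φ : ℕ}
  {π : F}

/-- If the valuation of `F` has ramification index `φ` over `E` and `π` is a uniformizer, then the
terms of a polynomial in `π` of degree less than `φ` have distinct valuations. -/
theorem AddValuation.map_sum_mul_pow_le
    (hE : ∀ x : E, x ≠ 0 → ∃ k : ℤ, v (algebraMap E F x) = ((φ : ℤ) * k : ℤ))
    (hπ : v π = (1 : ℤ)) (c : ℕ → E) {j : ℕ} (hj : j < φ) :
    v (∑ i ∈ Finset.range φ, algebraMap E F (c i) * π ^ i) ≤ v (algebraMap E F (c j) * π ^ j) := by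
  have hval : ∀ i, c i ≠ 0 → ∃ k : ℤ, v (algebraMap E F (c i) * π ^ i) = ((φ : ℤ) * k + i : ℤ) := by
    intro i hi
    obtain ⟨k, hk⟩ := hE _ hi
    refine ⟨k, ?_⟩
    rw [v.map_mul_of_eq hk (v.map_pow_of_eq hπ i), mul_one]
  obtain ⟨i₀, hi₀, hmin⟩ := Finset.exists_min_image (Finset.range φ)
    (fun i => v (algebraMap E F (c i) * π ^ i)) ⟨j, Finset.mem_range.2 hj⟩
  rcases eq_or_ne (c i₀) 0 with h0 | h0
  · have h := hmin j (Finset.mem_range.2 hj)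
    simp only [h0, _root_.map_zero, zero_mul, AddValuation.map_zero, top_le_iff] at h
    rw [h]
    exact le_top
  refine le_trans (le_of_eq ?_) (hmin j (Finset.mem_range.2 hj))
  rw [← Finset.add_sum_erase _ _ hi₀]
  refine v.map_add_eq_of_lt_left ?_
  obtain ⟨k, hk⟩ := hval i₀ h0
  rw [hk]
  refine v.map_lt_sum' (WithTop.coe_lt_top _) fun i hi => ?_
  rw [Finset.mem_erase] at hi
  rw [← hk]
  refine lt_of_le_of_ne (hmin i hi.2) fun heq => hi.1 ?_
  rcases eq_or_ne (c i) 0 with hi0 | hi0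
  · rw [hk, hi0, _root_.map_zero, zero_mul, AddValuation.map_zero] at heq
    exact absurd heq WithTop.coe_ne_top
  obtain ⟨l, hl⟩ := hval i hi0
  rw [hk, hl, WithTop.coe_inj] at heq
  rw [Finset.mem_range] at hi₀
  have hi2 := Finset.mem_range.1 hi.2
  have h1 := congrArg (· % (φ : ℤ)) heq
  simp only [Int.mul_add_emod_self_left] at h1
  rw [Int.emod_eq_of_lt (by omega) (by omega), Int.emod_eq_of_lt (by omega) (by omega)] at h1
  omega

theorem AddValuation.le_natDegree_of_aeval_eq_zero
    (hE : ∀ x : E, x ≠ 0 → ∃ k : ℤ, v (algebraMap E F x) = ((φ : ℤ) * k : ℤ))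
    (hπ : v π = (1 : ℤ)) {q : E[X]} (hq : q ≠ 0) (h : aeval π q = 0) : φ ≤ q.natDegree := by
  by_contra! hlt
  have h1 := map_sum_mul_pow_le hE hπ q.coeff hlt
  simp only [← Algebra.smul_def] at h1
  rw [← aeval_eq_sum_range' hlt, h, AddValuation.map_zero, top_le_iff, AddValuation.top_iff,
    smul_eq_zero] at h1
  rcases h1 with h1 | h1
  · exact hq (leadingCoeff_eq_zero.1 h1)
  · exact v.ne_zero_of_eq hπ (eq_zero_of_pow_eq_zero h1)

theorem exists_eq_sum_mul_pow (hπ : IntermediateField.adjoin E {π} = ⊤) {q : E[X]} (hq : q ≠ 0)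
    (hφ : q.natDegree ≤ φ) (h : aeval π q = 0) (x : F) :
    ∃ c : ℕ → E, x = ∑ i ∈ Finset.range φ, algebraMap E F (c i) * π ^ i := by
  have hintegral : IsIntegral E π := isAlgebraic_iff_isIntegral.1 ⟨q, hq, h⟩
  have hx : x ∈ IntermediateField.adjoin E {π} := hπ ▸ IntermediateField.mem_top
  rw [← IntermediateField.mem_toSubalgebra,
    IntermediateField.adjoin_simple_toSubalgebra_of_isAlgebraic ⟨q, hq, h⟩,
    Algebra.adjoin_singleton_eq_range_aeval] at hx
  obtain ⟨f, rfl⟩ := hx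
  have hdeg : (f %ₘ minpoly E π).natDegree < φ :=
    lt_of_lt_of_le (natDegree_modByMonic_lt f (minpoly.monic hintegral)
      (minpoly.ne_one E π)) ((natDegree_le_of_dvd (minpoly.dvd E π h) hq).trans hφ)
  refine ⟨(f %ₘ minpoly E π).coeff, ?_⟩
  simp only [← Algebra.smul_def]
  rw [← aeval_eq_sum_range' hdeg]
  exact (minpoly.aeval_modByMonic_minpoly f π).symm

end EisensteinExtension

section CyclotomicExtension

open Polynomial

variable {E F : Type*} [Field E] [Field F] [Algebra E F] {v : AddValuation F (WithTop ℤ)} {m : ℕ}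
  [NeZero m] {ζ : F}

theorem aeval_comp_one_sub (q : E[X]) : aeval (1 - ζ) (q.comp (1 - X)) = aeval ζ q := by
  rw [aeval_comp]
  simp

theorem natDegree_comp_one_sub (q : E[X]) : (q.comp (1 - X)).natDegree = q.natDegree := by
  have : (1 - X : E[X]).natDegree = 1 := by
    rw [← neg_sub, natDegree_neg, ← C_1, natDegree_X_sub_C]
  rw [natDegree_comp, this, mul_one]

theorem comp_one_sub_ne_zero {q : E[X]} (hq : q ≠ 0) : q.comp (1 - X) ≠ 0 := by
  intro h
  have h1 := congrArg (fun t => t.comp (1 - X)) h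
  simp only [comp_assoc, sub_comp, one_comp, X_comp, sub_sub_cancel, comp_X, zero_comp] at h1
  exact hq h1

theorem IsPrimitiveRoot.minpoly_eq_cyclotomic_of_addValuation (hζ : IsPrimitiveRoot ζ m)
    (hE : ∀ x : E, x ≠ 0 → ∃ k : ℤ, v (algebraMap E F x) = ((m.totient : ℤ) * k : ℤ))
    (hπ : v (1 - ζ) = (1 : ℤ)) : minpoly E ζ = cyclotomic m E := by
  have hintegral : IsIntegral E ζ := (hζ.isIntegral (NeZero.pos m)).tower_top
  refine (eq_of_monic_of_dvd_of_natDegree_le (minpoly.monic hintegral) (cyclotomic.monic m E)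
    (minpoly.dvd E ζ ?_) ?_).symm
  · rw [aeval_def, eval₂_eq_eval_map, map_cyclotomic]
    exact hζ.isRoot_cyclotomic (NeZero.pos m)
  · rw [natDegree_cyclotomic, ← natDegree_comp_one_sub]
    refine AddValuation.le_natDegree_of_aeval_eq_zero hE hπ (comp_one_sub_ne_zero
      (minpoly.ne_zero hintegral)) ?_
    rw [aeval_comp_one_sub, minpoly.aeval]

theorem IsPrimitiveRoot.exists_eq_sum_mul_pow (hζ : IsPrimitiveRoot ζ m)
    (hF : IntermediateField.adjoin E {ζ} = ⊤) (x : F) :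
    ∃ c : ℕ → E, x = ∑ i ∈ Finset.range m.totient, algebraMap E F (c i) * (1 - ζ) ^ i := by
  refine _root_.exists_eq_sum_mul_pow ?_ (comp_one_sub_ne_zero (cyclotomic_ne_zero m E))
    (by rw [natDegree_comp_one_sub, natDegree_cyclotomic]) ?_ x
  · rw [eq_top_iff, ← hF, IntermediateField.adjoin_simple_le_iff]
    have := sub_mem (one_mem _) (IntermediateField.mem_adjoin_simple_self E (1 - ζ))
    rwa [sub_sub_cancel] at this
  · rw [aeval_comp_one_sub, aeval_def, eval₂_eq_eval_map, map_cyclotomic]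
    exact hζ.isRoot_cyclotomic (NeZero.pos m)

theorem IsPrimitiveRoot.exists_algEquiv_of_minpoly_eq_cyclotomic (hζ : IsPrimitiveRoot ζ m)
    (hF : IntermediateField.adjoin E {ζ} = ⊤) (h : minpoly E ζ = cyclotomic m E) {κ : ℕ}
    (hκ : κ.Coprime m) : ∃ σ : F ≃ₐ[E] F, σ ζ = ζ ^ κ := by
  have hintegral : IsIntegral E ζ := (hζ.isIntegral (NeZero.pos m)).tower_top
  have : Algebra.IsAlgebraic E (IntermediateField.adjoin E {ζ}) :=
    IntermediateField.isAlgebraic_adjoin_simple hintegral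
  have : Algebra.IsAlgebraic E F := by
    rw [hF] at this
    exact (IntermediateField.topEquiv (F := E) (E := F)).isAlgebraic
  have : IsCyclotomicExtension {m} E F := by
    have := hζ.intermediateField_adjoin_isCyclotomicExtension E
    rw [hF] at this
    exact IsCyclotomicExtension.equiv {m} E _ (IntermediateField.topEquiv (F := E) (E := F))
  have : IsGalois E F := IsCyclotomicExtension.isGalois {m} E F
  have hirr : Irreducible (cyclotomic m E) := h ▸ minpoly.irreducible hintegral
  have hκ' := hζ.pow_of_coprime κ hκ
  refine minpoly.exists_algEquiv_of_root' (Algebra.IsAlgebraic.isAlgebraic _) ?_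
  have : minpoly E (ζ ^ κ) = cyclotomic m E := by
    refine (minpoly.eq_of_irreducible_of_monic hirr ?_ (cyclotomic.monic m E)).symm
    rw [aeval_def, eval₂_eq_eval_map, map_cyclotomic]
    exact hκ'.isRoot_cyclotomic (NeZero.pos m)
  rw [h, ← this, minpoly.aeval]

end CyclotomicExtension

section CyclotomicAction

variable {E F : Type*} [Field E] [Field F] [Algebra E F] {v : AddValuation F (WithTop ℤ)} {φ : ℕ}

namespace AddValuation

theorem map_natCast_eq_zero_of_coprime {p : ℕ} (hp : (1 : ℤ) ≤ v (p : F)) {κ : ℕ}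
    (hκ : κ.Coprime p) : v (κ : F) = (0 : ℤ) := by
  have hκO : (κ : F) ∈ v.orderRing := natCast_mem _ κ
  have hbez : ((κ.gcdA p : ℤ) : F) * κ + ((κ.gcdB p : ℤ) : F) * p = 1 := by
    have h := Nat.gcd_eq_gcd_ab κ p
    rw [hκ.gcd_eq_one] at h
    have h' := congrArg (fun t : ℤ => (t : F)) h
    push_cast at h'
    linear_combination -h'
  have hnot : ¬ ((1 : ℤ) : WithTop ℤ) ≤ v (κ : F) := by
    intro hle
    have h1 : ((1 : ℤ) : WithTop ℤ) ≤ v (1 : F) := by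
      rw [← hbez]
      refine v.map_le_add ?_ ?_
      · rw [AddValuation.map_mul]
        exact le_add_of_nonneg_of_le (intCast_mem v.orderRing _) hle
      · rw [AddValuation.map_mul]
        exact le_add_of_nonneg_of_le (intCast_mem v.orderRing _) hp
    rw [AddValuation.map_one] at h1
    exact absurd h1 (by exact_mod_cast (by norm_num : ¬ (1 : ℤ) ≤ 0))
  have h0 : (κ : F) ≠ 0 := fun h => hnot (by simp [h])
  obtain ⟨k, hk⟩ := v.exists_int_eq h0
  rw [mem_orderRing, hk] at hκO
  rw [hk] at hnot ⊢
  have h1 : 0 ≤ k := by exact_mod_cast hκO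
  have h2 : ¬ 1 ≤ k := by exact_mod_cast hnot
  congr 1
  omega

theorem one_le_map_pow_sub_pow {x y : F} (hx : x ∈ v.orderRing) (hy : y ∈ v.orderRing)
    (h : (1 : ℤ) ≤ v (x - y)) (i : ℕ) : (1 : ℤ) ≤ v (x ^ i - y ^ i) := by
  obtain ⟨c, hc⟩ := sub_dvd_pow_sub_pow (⟨x, hx⟩ : v.orderRing) ⟨y, hy⟩ i
  have hc' : x ^ i - y ^ i = (x - y) * c := congrArg Subtype.val hc
  rw [hc', AddValuation.map_mul]
  exact le_add_of_le_of_nonneg h c.2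

/-- The quotient `σ (1 - ζ) / (1 - ζ)`, for an automorphism `σ` with `σ ζ = ζ ^ κ`, is congruent
to `κ`. -/
theorem one_le_map_geom_sum_sub {ζ : F} (hπ : v (1 - ζ) = (1 : ℤ)) (κ : ℕ) :
    (1 : ℤ) ≤ v (∑ i ∈ Finset.range κ, ζ ^ i - κ) := by
  have hζ : ζ ∈ v.orderRing := by
    have := sub_mem (one_mem v.orderRing) (show 1 - ζ ∈ v.orderRing by
      rw [mem_orderRing, hπ]; exact_mod_cast zero_le_one)
    rwa [sub_sub_cancel] at this
  have h : ∑ i ∈ Finset.range κ, ζ ^ i - κ = ∑ i ∈ Finset.range κ, (ζ ^ i - 1 ^ i) := by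
    simp
  rw [h]
  refine v.map_le_sum fun i _ => one_le_map_pow_sub_pow hζ (one_mem _) ?_ i
  rw [AddValuation.map_sub_swap, hπ]

/-- An automorphism of an Eisenstein extension fixing the base preserves the valuation ring and
acts trivially on the residue field. -/
theorem one_le_map_sub_of_mem_orderRing
    (hE : ∀ x : E, x ≠ 0 → ∃ k : ℤ, v (algebraMap E F x) = ((φ : ℤ) * k : ℤ)) {π : F}
    (hπ : v π = (1 : ℤ))
    (hF : ∀ x : F, ∃ c : ℕ → E, x = ∑ i ∈ Finset.range φ, algebraMap E F (c i) * π ^ i)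
    {σ : F ≃ₐ[E] F} {ε : F} (hε : ε ∈ v.orderRing) (hσ : σ π = π * ε) {α : F}
    (hα : α ∈ v.orderRing) : (1 : ℤ) ≤ v (σ α - α) := by
  obtain ⟨c, hc⟩ := hF α
  have h : σ α - α = ∑ i ∈ Finset.range φ, algebraMap E F (c i) * π ^ i * (ε ^ i - 1) := by
    rw [hc, _root_.map_sum, ← Finset.sum_sub_distrib]
    refine Finset.sum_congr rfl fun i _ => ?_
    rw [_root_.map_mul, _root_.map_pow, AlgEquiv.commutes, hσ]
    ring
  rw [h]
  refine v.map_le_sum fun i hi => ?_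
  rw [Finset.mem_range] at hi
  rcases Nat.eq_zero_or_pos i with rfl | hi0
  · simp
  have hle : 0 ≤ v (algebraMap E F (c i) * π ^ i) := by
    refine le_trans hα ?_
    rw [hc]
    exact map_sum_mul_pow_le hE hπ c hi
  rw [AddValuation.map_mul]
  refine le_add_of_le_of_nonneg ?_ (sub_mem (pow_mem hε i) (one_mem v.orderRing))
  rcases eq_or_ne (c i) 0 with h0 | h0
  · simp [h0]
  obtain ⟨k, hk⟩ := hE _ h0
  rw [v.map_mul_of_eq hk (v.map_pow_of_eq hπ i)] at hle ⊢
  have h1 : 0 ≤ (φ : ℤ) * k + i * 1 := by exact_mod_cast hle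
  have h2 : 1 ≤ (φ : ℤ) * k + i * 1 := by
    refine lt_of_le_of_ne h1 fun heq => ?_
    have h3 : (φ : ℤ) ∣ i := ⟨-k, by linarith⟩
    exact absurd (Int.le_of_dvd (by exact_mod_cast hi0) h3) (by omega)
  exact_mod_cast h2

end AddValuation

theorem Nat.prime_dvd_pow_prime_pow_sub {p : ℕ} [Fact p.Prime] (κ n : ℕ) :
    (p : ℤ) ∣ (κ : ℤ) ^ p ^ n - κ := by
  rw [← ZMod.intCast_zmod_eq_zero_iff_dvd]
  push_cast
  rw [ZMod.pow_card_pow, sub_self]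

end CyclotomicAction

section KummerClosure

variable (F : Type*) [Field F] (m : ℕ)

/-- The extension of `F` generated by all `m`-th roots of elements of `F`. -/
noncomputable def kummerClosure : IntermediateField F (AlgebraicClosure F) :=
  IntermediateField.adjoin F {z | ∃ a : F, z ^ m = algebraMap F (AlgebraicClosure F) a}

variable {F m}

theorem mem_kummerClosure {z : AlgebraicClosure F} {a : F}
    (h : z ^ m = algebraMap F (AlgebraicClosure F) a) : z ∈ kummerClosure F m :=
  IntermediateField.subset_adjoin _ _ ⟨a, h⟩

theorem hasKummerRoots_kummerClosure (hm : 0 < m) : HasKummerRoots F (kummerClosure F m) m := by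
  intro a
  obtain ⟨z, hz⟩ := IsAlgClosed.exists_pow_nat_eq (algebraMap F (AlgebraicClosure F) a) hm
  have hz0 : (⟨z, mem_kummerClosure hz⟩ : kummerClosure F m) ≠ 0 := by
    intro h
    have h' : z = 0 := congrArg Subtype.val h
    rw [h', zero_pow hm.ne'] at hz
    exact a.ne_zero ((map_eq_zero _).1 hz.symm)
  exact ⟨Units.mk0 _ hz0, Units.ext (Subtype.ext hz)⟩

theorem map_mem_kummerClosure {σ : F →+* F} {τ : AlgebraicClosure F →+* AlgebraicClosure F}
    (hτ : ∀ x, τ (algebraMap F (AlgebraicClosure F) x) = algebraMap F (AlgebraicClosure F) (σ x))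
    {z : AlgebraicClosure F} (hz : z ∈ kummerClosure F m) : τ z ∈ kummerClosure F m := by
  induction hz using IntermediateField.adjoin_induction with
  | mem x hx =>
    obtain ⟨a, ha⟩ := hx
    exact mem_kummerClosure (a := σ a) (by rw [← map_pow, ha, hτ])
  | algebraMap x =>
    rw [hτ]
    exact algebraMap_mem _ _
  | add x y _ _ hx hy => rw [map_add]; exact add_mem hx hy
  | inv x _ hx => rw [map_inv₀]; exact inv_mem hx
  | mul x y _ _ hx hy => rw [map_mul]; exact mul_mem hx hy

theorem exists_ringEquiv_kummerClosure (σ : F ≃+* F) :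
    ∃ τ : kummerClosure F m ≃+* kummerClosure F m,
      ∀ x, τ (algebraMap F _ x) = algebraMap F _ (σ x) := by
  let τ := IsAlgClosure.equivOfEquiv (AlgebraicClosure F) (AlgebraicClosure F) σ
  have h1 : ∀ z ∈ kummerClosure F m, τ z ∈ kummerClosure F m := fun z hz =>
    map_mem_kummerClosure (σ := σ) (τ := τ) (IsAlgClosure.equivOfEquiv_algebraMap _ _ σ) hz
  have h2 : ∀ z ∈ kummerClosure F m, τ.symm z ∈ kummerClosure F m := fun z hz =>
    map_mem_kummerClosure (σ := σ.symm) (τ := τ.symm)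
      (IsAlgClosure.equivOfEquiv_symm_algebraMap _ _ σ) hz
  exact ⟨{ toFun := fun z => ⟨τ z, h1 z z.2⟩
           invFun := fun z => ⟨τ.symm z, h2 z z.2⟩
           left_inv := fun z => Subtype.ext (τ.symm_apply_apply z)
           right_inv := fun z => Subtype.ext (τ.apply_symm_apply z)
           map_add' := fun x y => Subtype.ext (map_add τ _ _)
           map_mul' := fun x y => Subtype.ext (map_mul τ _ _) },
    fun x => Subtype.ext (IsAlgClosure.equivOfEquiv_algebraMap _ _ σ x)⟩

instance normal_kummerClosure : Normal F (kummerClosure F m) := by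
  rw [IntermediateField.normal_iff_forall_map_le']
  rintro τ _ ⟨z, hz, rfl⟩
  exact map_mem_kummerClosure (σ := RingHom.id F) (τ := (τ : AlgebraicClosure F →+* _))
    (fun x => τ.commutes x) hz

theorem finiteDimensional_kummerClosure (hm : 0 < m)
    (h : ∃ S : Set Fˣ, S.Finite ∧ ∀ x : Fˣ, ∃ s ∈ S, ∃ w : Fˣ, x = s * w ^ m) :
    FiniteDimensional F (kummerClosure F m) := by
  classical
  obtain ⟨S, hS, hS'⟩ := h
  let T : Set (AlgebraicClosure F) :=
    ⋃ s ∈ S, {z | z ^ m = algebraMap F (AlgebraicClosure F) s}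
  have hT : T.Finite := by
    refine hS.biUnion fun s _ => ?_
    refine ((Polynomial.nthRoots m (algebraMap F (AlgebraicClosure F) s)).toFinset.finite_toSet).subset
      fun z hz => ?_
    simpa [Polynomial.mem_nthRoots hm] using hz
  have : Finite T := hT
  have hfin : FiniteDimensional F (IntermediateField.adjoin F T) :=
    IntermediateField.finiteDimensional_adjoin fun x _ =>
      (AlgebraicClosure.isAlgebraic F).isAlgebraic x |>.isIntegral
  have hle : kummerClosure F m ≤ IntermediateField.adjoin F T := by
    refine IntermediateField.adjoin_le_iff.2 ?_
    rintro z ⟨a, ha⟩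
    rcases eq_or_ne a 0 with rfl | ha0
    · rw [map_zero] at ha
      rw [eq_zero_of_pow_eq_zero ha]
      exact zero_mem _
    obtain ⟨s, hs, w, hw⟩ := hS' (Units.mk0 a ha0)
    have hw' : a = s * (w : F) ^ m := by simpa using congrArg Units.val hw
    have hw0 : algebraMap F (AlgebraicClosure F) w ≠ 0 := by simp
    have hz : z = z / algebraMap F (AlgebraicClosure F) w * algebraMap F (AlgebraicClosure F) w := by
      field_simp
    rw [hz]
    refine mul_mem (IntermediateField.subset_adjoin _ _ ?_) (algebraMap_mem _ _)
    refine Set.mem_biUnion hs ?_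
    change _ ^ m = _
    rw [div_pow, ha, hw', map_mul, map_pow, mul_div_cancel_right₀ _ (pow_ne_zero _ hw0)]
  exact Module.Finite.of_injective (IntermediateField.inclusion hle).toLinearMap
    (IntermediateField.inclusion_injective hle)

end KummerClosure

section NormTransfer

theorem IntermediateField.exists_norm_adjoin_coe {F Ω : Type*} [Field F] [Field Ω] [Algebra F Ω]
    {L : IntermediateField F Ω} {y : L} {b : F}
    (h : ∃ z : IntermediateField.adjoin F {y}, Algebra.norm F z = b) :
    ∃ z : IntermediateField.adjoin F {(y : Ω)}, Algebra.norm F z = b := by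
  obtain ⟨z, hz⟩ := h
  let e := (IntermediateField.liftAlgEquiv (IntermediateField.adjoin F {y})).trans
    (IntermediateField.equivOfEq (IntermediateField.lift_adjoin_simple F L y))
  exact ⟨e z, by rw [← hz, Algebra.norm_eq_of_algEquiv e z]⟩

end NormTransfer

theorem memFr.exists_units_map_eq {p n : ℕ} [Fact p.Prime] {E F : Type} [Field E] [Field F]
    [Algebra E F] {ζ : F} {r : ℤ} {a : Fˣ} (ha : memFr p n E ζ r a) {σ : F ≃ₐ[E] F}
    {u : (ZMod (p ^ n))ˣ} (hσ : σ ζ = ζ ^ (u : ZMod (p ^ n)).val) :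
    ∃ w : Fˣ, Units.map ((σ : F ≃+* F) : F →* F) a =
      a ^ ((u ^ r : (ZMod (p ^ n))ˣ) : ZMod (p ^ n)).val * w ^ p ^ n := by
  obtain ⟨w, hw⟩ := ha.2 σ u hσ
  have hw0 : w ≠ 0 := by
    rintro rfl
    rw [zero_pow (pow_ne_zero _ (Fact.out : p.Prime).ne_zero)] at hw
    simp at hw
  refine ⟨Units.mk0 w hw0, Units.ext ?_⟩
  simp only [Units.coe_map, Units.val_mul, Units.val_pow_eq_pow_val, Units.val_mk0, ← hw]
  field_simp
  rfl

theorem exists_unit_zmod_prime_pow {p n : ℕ} [Fact p.Prime] (hn : 1 ≤ n) {t : ℤ}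
    (ht : ¬ t ≡ 1 [ZMOD ((p : ℤ) - 1)]) :
    ∃ u : (ZMod (p ^ n))ˣ, ZMod.unitsMap (dvd_pow_self p (by omega : n ≠ 0)) u ^ t ≠
      ZMod.unitsMap (dvd_pow_self p (by omega : n ≠ 0)) u := by
  obtain ⟨g, hg⟩ := IsCyclic.exists_generator (α := (ZMod p)ˣ)
  have : NeZero (p ^ n) := ⟨pow_ne_zero _ (Fact.out : p.Prime).ne_zero⟩
  obtain ⟨u, hu⟩ := ZMod.unitsMap_surjective (dvd_pow_self p (by omega : n ≠ 0)) g
  refine ⟨u, fun h => ht ?_⟩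
  rw [hu] at h
  have h1 : g ^ (t - 1) = 1 := by rw [zpow_sub_one, h, mul_inv_cancel]
  rw [← orderOf_dvd_iff_zpow_eq_one, orderOf_eq_card_of_forall_mem_zpowers hg,
    Nat.card_eq_fintype_card, ZMod.card_units, Nat.cast_pred (Fact.out : p.Prime).pos] at h1
  exact (Int.modEq_iff_dvd.2 h1).symm

theorem ZMod.natCast_val_unit {m d : ℕ} [NeZero m] (h : d ∣ m) (u : (ZMod m)ˣ) :
    (((u : ZMod m).val : ℕ) : ZMod d) = (ZMod.unitsMap h u : (ZMod d)ˣ) := by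
  rw [ZMod.natCast_val, ZMod.unitsMap_val]

theorem exists_cyclotomic_automorphism {p n : ℕ} [Fact p.Prime] (hp : Odd p) {E F : Type}
    [Field E] [Field F] [Algebra E F] [Algebra ℚ_[p] F] [FiniteDimensional ℚ_[p] F] {ζ : F}
    (hζ : IsPrimitiveRoot ζ (p ^ n)) (hF : IntermediateField.adjoin E {ζ} = ⊤)
    {v : AddValuation F (WithTop ℤ)} (hπ : v (1 - ζ) = (1 : ℤ)) {e : ℤ} (he : 0 < e)
    (hφ : ((p ^ n).totient : ℤ) = e) (hN : ((p ^ n : ℕ) : ℤ) * (p - 1) = p * e)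
    (hvp : v (p : F) = e)
    (hv : ∀ x : ℚ_[p], x ≠ 0 → v (algebraMap ℚ_[p] F x) = (e * x.valuation : ℤ))
    (hE : ∀ x : E, x ≠ 0 → ∃ k : ℤ, v (algebraMap E F x) = (e * k : ℤ)) {κ : ℕ}
    (hκ : κ.Coprime p) :
    ∃ σ : F ≃ₐ[E] F, σ ζ = ζ ^ κ ∧
      ∀ {Q : Type} [CommGroup Q] (c : Fˣ →* Fˣ →* Q),
        (∀ x y : Fˣ, (x : F) + y = 1 → c x y = 1) → ∀ x y,
          c (Units.map ((σ : F ≃+* F) : F →* F) x) (Units.map ((σ : F ≃+* F) : F →* F) y) /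
            c x y ^ κ ∈ symbolPowers c p 1 := by
  have : NeZero (p ^ n) := ⟨pow_ne_zero _ (Fact.out : p.Prime).ne_zero⟩
  subst hφ
  obtain ⟨σ, hσ⟩ := hζ.exists_algEquiv_of_minpoly_eq_cyclotomic hF
    (hζ.minpoly_eq_cyclotomic_of_addValuation hE hπ) (hκ.pow_right n)
  refine ⟨σ, hσ, fun {Q} _ c hS => ?_⟩
  have hp1 : ((1 : ℤ) : WithTop ℤ) ≤ v (p : F) := by
    rw [hvp]
    exact_mod_cast he
  let π : Fˣ := Units.mk0 _ (v.ne_zero_of_eq hπ)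
  have hO := v.isLocalOrder he hv hvp (π := π) hπ hN
  have hgeom := AddValuation.one_le_map_geom_sum_sub hπ κ
  have hε₀ : v (∑ i ∈ Finset.range κ, ζ ^ i) = (0 : ℤ) := by
    have hκ0 := AddValuation.map_natCast_eq_zero_of_coprime hp1 hκ
    rw [← add_sub_cancel (κ : F) (∑ i ∈ Finset.range κ, ζ ^ i), v.map_add_eq_of_lt_left, hκ0]
    rw [hκ0]
    exact lt_of_lt_of_le (by exact_mod_cast zero_lt_one) hgeom
  obtain ⟨ε, hε, hε'⟩ := v.exists_units_of_eq_zero hε₀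
  have hεO : (ε : F) ∈ v.orderRing := by
    rw [hε]
    exact hε₀.ge
  have hσπ : σ (π : F) = π * ε := by
    rw [hε]
    simp only [π, Units.val_mk0, map_sub, map_one, hσ]
    exact (mul_neg_geom_sum ζ κ).symm
  have hres : ∀ α ∈ v.orderRing, ((1 : ℤ) : WithTop ℤ) ≤ v (σ α - α) := fun α hα =>
    AddValuation.one_le_map_sub_of_mem_orderRing hE hπ (hζ.exists_eq_sum_mul_pow hF) hεO hσπ hα
  have hdvd : ∀ {x : F}, ((1 : ℤ) : WithTop ℤ) ≤ v x → ∃ γ ∈ v.orderRing, x = γ * π :=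
    fun {x} hx => by simpa using (v.le_iff_exists_mul_pow (π := π) hπ 1).1 (by simpa using hx)
  refine hO.symbol_equivariant (Fact.out : p.Prime) hp (NeZero.one_le)
    (fun u hu => v.exists_pow_eq_one_add he hv hvp (π := π) hπ hN hu) (σ : F ≃+* F) ?_ ?_
    hσπ hεO hε' ?_ hS
  · intro α hα
    have h : σ α = σ α - α + α := by ring
    change σ α ∈ v.orderRing
    rw [h]
    exact add_mem (le_trans (by exact_mod_cast zero_le_one) (hres α hα)) hα
  · intro α hα
    obtain ⟨γ, hγ, h⟩ := hdvd (hres α hα)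
    exact ⟨γ, hγ, by rw [← h]; simp⟩
  · obtain ⟨d, hd⟩ := Nat.prime_dvd_pow_prime_pow_sub (p := p) κ n
    have hd' : (κ : F) ^ p ^ n - κ = p * d := by
      have := congrArg (fun t : ℤ => (t : F)) hd
      simpa using this
    have h : ((1 : ℤ) : WithTop ℤ) ≤ v ((ε : F) ^ p ^ n - κ) := by
      rw [← sub_add_sub_cancel _ ((κ : F) ^ p ^ n), hd']
      refine v.map_le_add (AddValuation.one_le_map_pow_sub_pow hεO (natCast_mem _ κ)
        (hε ▸ hgeom) _) ?_
      rw [AddValuation.map_mul]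
      exact le_add_of_le_of_nonneg hp1 (intCast_mem v.orderRing d)
    obtain ⟨γ, hγ, h⟩ := hdvd h
    exact ⟨γ, hγ, by rw [← h]; ring⟩

theorem symbol_mul_pow_eq {F Q : Type*} [Field F] [CommGroup Q] {c : Fˣ →* Fˣ →* Q} {m : ℕ}
    (hc : ∀ x y, c x y ^ m = 1) (a b w z : Fˣ) (i j : ℕ) :
    c (a ^ i * w ^ m) (b ^ j * z ^ m) = c a b ^ (i * j) := by
  have h1 : ∀ x, c x (b ^ j * z ^ m) = c x b ^ j := fun x => by
    rw [map_mul, map_pow, map_pow, hc, mul_one]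
  rw [h1, map_mul, map_pow, map_pow, MonoidHom.mul_apply, MonoidHom.pow_apply,
    MonoidHom.pow_apply, hc, mul_one, pow_mul]

theorem cupSymbol_eq_one_of_memFr {p n : ℕ} [Fact p.Prime] (hp : Odd p) (hn : 1 ≤ n) {E F L : Type}
    [Field E] [Field F] [Field L] [Algebra E F] [Algebra F L] [Algebra ℚ_[p] F]
    [FiniteDimensional ℚ_[p] F] [NeZero (p ^ n)] {ζ : Fˣ} (hζ : IsPrimitiveRoot ζ (p ^ n))
    (hF : IntermediateField.adjoin E {(ζ : F)} = ⊤)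
    {v : AddValuation F (WithTop ℤ)} (hπ : v (1 - (ζ : F)) = (1 : ℤ)) {e : ℤ} (he : 0 < e)
    (hφ : ((p ^ n).totient : ℤ) = e) (hN : ((p ^ n : ℕ) : ℤ) * (p - 1) = p * e)
    (hvp : v (p : F) = e)
    (hv : ∀ x : ℚ_[p], x ≠ 0 → v (algebraMap ℚ_[p] F x) = (e * x.valuation : ℤ))
    (hE : ∀ x : E, x ≠ 0 → ∃ k : ℤ, v (algebraMap E F x) = (e * k : ℤ))
    (hr : HasKummerRoots F L (p ^ n))
    (hL : ∀ σ : F ≃+* F, ∃ τ : L ≃+* L, ∀ x, τ (algebraMap F L x) = algebraMap F L (σ x))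
    {r s : ℤ} (hrs : ¬ r + s ≡ 1 [ZMOD ((p : ℤ) - 1)]) {a b : Fˣ}
    (ha : memFr p n E (ζ : F) r a) (hb : memFr p n E (ζ : F) s b) :
    cupSymbol hr hζ a b = 1 := by
  obtain ⟨u, hu⟩ := exists_unit_zmod_prime_pow hn hrs
  have hκ : (u : ZMod (p ^ n)).val.Coprime p :=
    (Nat.coprime_pow_right_iff (by omega) _ _).1 (ZMod.val_coe_unit_coprime u)
  obtain ⟨σ, hσ, hsymb⟩ := exists_cyclotomic_automorphism hp (IsPrimitiveRoot.coe_units_iff.2 hζ)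
    hF hπ he hφ hN hvp hv hE hκ
  obtain ⟨τ, hτ⟩ := hL (σ : F ≃+* F)
  obtain ⟨θ, hθ⟩ := exists_hom_cupSymbol hr hζ (σ : F ≃+* F) τ hτ _ hσ
  have hc : ∀ x y, cupSymbol hr hζ x y ^ p ^ n = 1 := fun x y => cupSymbol_pow_eq_one hr hζ
  obtain ⟨w, hw⟩ := ha.exists_units_map_eq hσ
  obtain ⟨z, hz⟩ := hb.exists_units_map_eq hσ
  refine symbol_eq_one_of_eigen (θ := θ) (κ := (u : ZMod (p ^ n)).val) (Fact.out : p.Prime) hc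
    (fun x y => ?_) (A := ((u ^ r : (ZMod (p ^ n))ˣ) : ZMod (p ^ n)).val *
      ((u ^ s : (ZMod (p ^ n))ˣ) : ZMod (p ^ n)).val) ?_ ?_
  · rw [hθ]
    exact hsymb (cupSymbol hr hζ) (fun x y h => cupSymbol_steinberg hr hζ h) x y
  · rw [hθ, hw, hz, symbol_mul_pow_eq hc]
  · have hn0 : n ≠ 0 := by omega
    rw [Nat.cast_mul, ZMod.natCast_val_unit (dvd_pow_self p hn0),
      ZMod.natCast_val_unit (dvd_pow_self p hn0), ZMod.natCast_val_unit (dvd_pow_self p hn0),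
      map_zpow, map_zpow, ← Units.val_mul, ← zpow_add]
    exact fun h => hu (Units.ext h)

/-- If `r + s ≢ 1 (mod p-1)`, then every `b ∈ F^s` is a norm from
`K = F(a^{1/p^n})` for every `a ∈ F^r`. -/
theorem norm_of_sum_not_cong_one (p n : ℕ) [Fact p.Prime] (hp : Odd p) (hn : 1 ≤ n)
    (E F : Type) [Field E] [Field F] [Algebra ℚ_[p] E] [Algebra E F]
    [Algebra ℚ_[p] F] [IsScalarTower ℚ_[p] E F] [FiniteDimensional ℚ_[p] E]
    (ζ : F) (hζ : IsPrimitiveRoot ζ (p ^ n))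
    (hF : IntermediateField.adjoin E {ζ} = ⊤)
    (v : AddValuation F (WithTop ℤ))
    (hv1 : v (1 - ζ) = (1 : WithTop ℤ))
    (hvp : v ((p : F)) = (((p : ℤ) ^ (n - 1) * ((p : ℤ) - 1) : ℤ) : WithTop ℤ))
    (hunram : ∀ x : E, x ≠ 0 →
      ∃ k : ℤ, v (algebraMap E F x) = ((((p : ℤ) ^ (n - 1) * ((p : ℤ) - 1)) * k : ℤ) : WithTop ℤ))
    (r s : ℤ) (hrs : ¬ r + s ≡ 1 [ZMOD ((p : ℤ) - 1)])
    (a b : F) (ha : memFr p n E ζ r a) (hb : memFr p n E ζ s b)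
    (y : AlgebraicClosure F) (hy : y ^ (p ^ n) = algebraMap F (AlgebraicClosure F) a) :
    isNormFrom y b := by
  have hpp : p.Prime := Fact.out
  have : NeZero (p ^ n) := ⟨pow_ne_zero _ hpp.ne_zero⟩
  have hn0 : n ≠ 0 := by omega
  have : FiniteDimensional E F := by
    have := IntermediateField.adjoin.finiteDimensional (K := E)
      (hζ.isIntegral (NeZero.pos (p ^ n))).tower_top
    rw [hF] at this
    exact Module.Finite.equiv (IntermediateField.topEquiv (F := E) (E := F)).toLinearEquiv
  have : FiniteDimensional ℚ_[p] F := FiniteDimensional.trans ℚ_[p] E F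
  set e : ℤ := (p : ℤ) ^ (n - 1) * ((p : ℤ) - 1) with he_def
  have hp2 : (2 : ℤ) ≤ p := by exact_mod_cast hpp.two_le
  have he : 0 < e := mul_pos (pow_pos (by omega) _) (by omega)
  have hφ : ((p ^ n).totient : ℤ) = e := by
    rw [Nat.totient_prime_pow hpp (by omega), Nat.cast_mul, Nat.cast_pow, Nat.cast_pred hpp.pos]
  have hN : ((p ^ n : ℕ) : ℤ) * (p - 1) = p * e := by
    rw [he_def, Nat.cast_pow, ← mul_pow_sub_one hn0 (p : ℤ)]
    ring
  have hv : ∀ x : ℚ_[p], x ≠ 0 → v (algebraMap ℚ_[p] F x) = (e * x.valuation : ℤ) :=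
    fun x hx => v.map_algebraMap_padic hp he hvp (fun z hz => by
      obtain ⟨k, hk⟩ := hunram (algebraMap ℚ_[p] E z) (by simpa using hz)
      exact ⟨k, by rwa [← IsScalarTower.algebraMap_apply] at hk⟩) hx
  have hfin : FiniteDimensional F (kummerClosure F (p ^ n)) :=
    finiteDimensional_kummerClosure (NeZero.pos _) (exists_finite_mod_pow
      (v.exists_finite_mod_prime_pow he hv hvp
        (π := Units.mk0 _ (v.ne_zero_of_eq (k := 1) hv1)) hv1 hN) n)
  have : CharZero F := charZero_of_injective_algebraMap (algebraMap ℚ_[p] F).injective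
  have : IsGalois F (kummerClosure F (p ^ n)) := {}
  have hr := hasKummerRoots_kummerClosure (F := F) (NeZero.pos (p ^ n))
  lift a to Fˣ using isUnit_iff_ne_zero.2 ha.1
  lift b to Fˣ using isUnit_iff_ne_zero.2 hb.1
  obtain ⟨ζ, rfl⟩ := hζ.isUnit (NeZero.ne _)
  have hζ' : IsPrimitiveRoot ζ (p ^ n) := IsPrimitiveRoot.coe_units_iff.1 hζ
  have hab : cupSymbol hr hζ' a b = 1 :=
    cupSymbol_eq_one_of_memFr hp hn hζ' hF hv1 he hφ hN hvp hv hunram hr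
      exists_ringEquiv_kummerClosure hrs ha hb
  obtain ⟨y, rfl⟩ : ∃ z : kummerClosure F (p ^ n), (z : AlgebraicClosure F) = y :=
    ⟨⟨y, mem_kummerClosure hy⟩, rfl⟩
  have hy' : y ^ p ^ n = algebraMap F (kummerClosure F (p ^ n)) a := Subtype.ext hy
  obtain ⟨y, rfl⟩ : IsUnit y := (isUnit_pow_iff (NeZero.ne (p ^ n))).1
    (hy' ▸ a.isUnit.map (algebraMap F (kummerClosure F (p ^ n))))
  exact IntermediateField.exists_norm_adjoin_coe
    (exists_norm_eq_of_cupSymbol_eq_one hr hζ' y (Units.ext hy') hab)
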